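/- arXiv:2002.02541 — 5 statements merged into one kernel-verified Lean document; each statement's English description precedes it below -/
import Mathlib

section
/- There exist k : ℕ, a group G, and a generating tuple s : Fin k → G (so (G,s) is a marked group) such that G is residually finite, the word problem W(G,s) is a computable predicate, but the extension predicate E(G,s) is NOT a computable predicate. That is, there exists a finitely generated residually finite group with solvable word problem whose finite quotients are not computable. -/
namespace CFQ

theorem primrec_factorial : Primrec Nat.factorial := by
  have h : Primrec fun n : ℕ =>
      Nat.rec (motive := fun _ => ℕ) 1 (fun m ih => (m + 1) * ih) n :=
    Primrec.nat_rec₁ 1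
      (Primrec.nat_mul.comp (Primrec.succ.comp Primrec.fst) Primrec.snd)
  refine h.of_eq fun n => ?_
  induction n with
  | zero => rfl
  | succ n ih =>
    show (n + 1) * (Nat.rec (motive := fun _ => ℕ) 1 (fun m ih => (m + 1) * ih) n)
        = (n + 1).factorial
    rw [ih, Nat.factorial_succ]

theorem primrec_pow_const : ∀ k : ℕ, Primrec fun n : ℕ => n ^ k
  | 0 => (Primrec.const 1).of_eq fun n => (pow_zero n).symm
  | k + 1 => (Primrec.nat_mul.comp (primrec_pow_const k) Primrec.id).of_eq
      fun n => (pow_succ n k).symm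

/-- A `Primcodable` structure on the type of pairs of a natural number `n` and a
`k`-tuple of permutations of `Fin n`. -/
noncomputable instance sigmaPermPrimcodable (k : ℕ) :
    Primcodable (Σ n : ℕ, Fin k → Equiv.Perm (Fin n)) :=
  letI : Primcodable {m : ℕ // m.unpair.2 < m.unpair.1.factorial ^ k} :=
    Primcodable.subtype
      (Primrec.nat_lt.comp (Primrec.snd.comp Primrec.unpair)
        ((primrec_pow_const k).comp (primrec_factorial.comp (Primrec.fst.comp Primrec.unpair))))
  Primcodable.ofEquiv {m : ℕ // m.unpair.2 < m.unpair.1.factorial ^ k} <|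
    (Equiv.sigmaCongrRight fun n =>
      (Fintype.equivFinOfCardEq
        (by simp [Fintype.card_fun, Fintype.card_perm]) :
          (Fin k → Equiv.Perm (Fin n)) ≃ Fin (n.factorial ^ k))).trans
    { toFun := fun p => ⟨Nat.pair p.1 p.2, by simp⟩
      invFun := fun m => ⟨m.1.unpair.1, ⟨m.1.unpair.2, m.2⟩⟩
      left_inv := fun p => by
        rcases p with ⟨n, i⟩
        refine Sigma.ext (by simp) ?_
        rw [Fin.heq_ext_iff (by simp)]
        simp
      right_inv := fun m => by
        apply Subtype.ext
        simp }

/-- The extension predicate of a marked group. -/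
def ExtPred {k : ℕ} {G : Type*} [Group G] (s : Fin k → G)
    (p : Σ n : ℕ, Fin k → Equiv.Perm (Fin n)) : Prop :=
  ∃ φ : G →* Equiv.Perm (Fin p.1), ∀ i, φ (s i) = p.2 i

/-- The word problem of a marked group. -/
def WordProb {k : ℕ} {G : Type*} [Group G] (s : Fin k → G)
    (w : List (Fin k × Bool)) : Prop :=
  FreeGroup.lift s (FreeGroup.mk w) = 1

/-- A predicate is recursively enumerable if it is the domain of a partial
computable function. -/
def RePred {α : Type*} [Primcodable α] (p : α → Prop) : Prop :=
  ∃ f : α →. Unit, Partrec f ∧ ∀ a, p a ↔ (f a).Dom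

/-- A group is residually finite if every nontrivial element has nontrivial
image in some finite quotient (equivalently, some symmetric group). -/
def ResiduallyFinite (G : Type*) [Group G] : Prop :=
  ∀ g : G, g ≠ 1 → ∃ (n : ℕ) (φ : G →* Equiv.Perm (Fin n)), φ g ≠ 1

open Encodable

theorem re_exists_of_computablePred {α β : Type*} [Primcodable α] [Primcodable β]
    {P : α → β → Prop} (hP : ComputablePred fun p : α × β => P p.1 p.2) :
    REPred fun a => ∃ b, P a b := by
  classical
  have hdec : Computable fun p : α × β => decide (P p.1 p.2) := hP.decide
  have hstep : Computable₂ fun (a : α) (n : ℕ) =>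
      (decode n : Option β).bind fun b => cond (decide (P a b)) (some ()) none :=
    Computable.option_bind (Computable.decode.comp Computable.snd)
      (Computable.cond (hdec.comp ((Computable.fst.comp Computable.fst).pair Computable.snd))
        (Computable.const _) (Computable.const _)).to₂
  refine (Partrec.rfindOpt hstep).dom_re.of_eq fun a => ?_
  rw [Nat.rfindOpt_dom]
  constructor
  · rintro ⟨n, u, hu⟩
    simp only [Option.mem_def, Option.bind_eq_some_iff] at hu
    obtain ⟨b, -, hb⟩ := hu
    refine ⟨b, ?_⟩
    by_contra hab
    simp [hab] at hb
  · rintro ⟨b, hb⟩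
    exact ⟨encode b, (), by simp [hb]⟩

theorem computablePred_and {α : Type*} [Primcodable α] {p q : α → Prop}
    (hp : ComputablePred p) (hq : ComputablePred q) : ComputablePred fun a => p a ∧ q a := by
  classical
  exact ((Primrec.and.to_comp.comp hp.decide hq.decide).of_eq fun a => by simp).computablePred

theorem primrecPred_forall_fin {α : Type*} [Primcodable α] {k : ℕ} {P : Fin k → α → Prop}
    (hP : PrimrecRel P) : PrimrecPred fun a => ∀ i, P i a :=
  (hP.forall_mem_list.comp (Primrec.const (List.finRange k)) Primrec.id).of_eq fun a => by simp

theorem primrecPred_forall_mem {α β : Type*} [Primcodable α] [Primcodable β]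
    {P : β → α → Prop} {l : α → List β} (hl : Primrec l) (hP : PrimrecRel P) :
    PrimrecPred fun a => ∀ x ∈ l a, P x a :=
  PrimrecRel.comp (R := fun l a => ∀ x ∈ l, P x a) hP.forall_mem_list hl Primrec.id

theorem primrecPred_forall_lt {α : Type*} [Primcodable α] {P : ℕ → α → Prop} {b : α → ℕ}
    (hb : Primrec b) (hP : PrimrecRel P) : PrimrecPred fun a => ∀ x < b a, P x a :=
  (primrecPred_forall_mem (Primrec.list_range.comp hb) hP).of_eq fun a => by simp

section TupleCodes

variable {k n : ℕ}

/-- The table of values of a tuple of permutations of `Fin n`. -/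
def tupleCode (f : Fin k → Equiv.Perm (Fin n)) (i : Fin k) : List ℕ :=
  List.ofFn fun x => (f i x : ℕ)

/-- The lists `T i` tabulate permutations of `{0, …, n - 1}`. -/
def IsTupleCode (n : ℕ) (T : Fin k → List ℕ) : Prop :=
  ∀ i, (T i).length = n ∧ ∀ x < n, x ∈ T i

/-- The action of a word on numbers, computed from tables of permutations. -/
def wordAct (T : Fin k → List ℕ) (w : List (Fin k × Bool)) (x : ℕ) : ℕ :=
  w.foldr (fun l y => cond l.2 ((T l.1).getD y 0) ((T l.1).idxOf y)) x

/-- The word `w` acts trivially on `{0, …, n - 1}` through the tables `T`. -/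
def Kills (n : ℕ) (T : Fin k → List ℕ) (w : List (Fin k × Bool)) : Prop :=
  ∀ x < n, wordAct T w x = x

theorem tupleCode_injective :
    Function.Injective (tupleCode : (Fin k → Equiv.Perm (Fin n)) → Fin k → List ℕ) := by
  intro f g h
  funext i
  ext x
  have := List.ofFn_injective (congrFun h i)
  exact congrFun this x

theorem idxOf_ofFn_perm (σ : Equiv.Perm (Fin n)) (x : Fin n) :
    (List.ofFn fun y => (σ y : ℕ)).idxOf (x : ℕ) = (σ⁻¹ x : Fin n) := by
  have hnd : (List.ofFn fun y => (σ y : ℕ)).Nodup :=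
    List.nodup_ofFn.2 (Fin.val_injective.comp σ.injective)
  have hlt : ((σ⁻¹ x : Fin n) : ℕ) < (List.ofFn fun y => (σ y : ℕ)).length := by simp
  have := hnd.idxOf_getElem _ hlt
  simpa using this

theorem wordAct_tupleCode (f : Fin k → Equiv.Perm (Fin n)) (w : List (Fin k × Bool)) (x : Fin n) :
    wordAct (tupleCode f) w x = (FreeGroup.lift f (FreeGroup.mk w) x : Fin n) := by
  induction w with
  | nil => simp [wordAct]
  | cons l w ih =>
    obtain ⟨i, b⟩ := l
    rw [FreeGroup.lift_mk] at ih ⊢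
    have hcons : wordAct (tupleCode f) ((i, b) :: w) x =
        cond b ((tupleCode f i).getD (wordAct (tupleCode f) w x) 0)
          ((tupleCode f i).idxOf (wordAct (tupleCode f) w x)) := rfl
    rw [hcons, ih, List.map_cons, List.prod_cons, Equiv.Perm.mul_apply]
    cases b
    · exact idxOf_ofFn_perm _ _
    · simp [tupleCode]

theorem kills_tupleCode {f : Fin k → Equiv.Perm (Fin n)} {w : List (Fin k × Bool)} :
    Kills n (tupleCode f) w ↔ FreeGroup.lift f (FreeGroup.mk w) = 1 := by
  constructor
  · intro h
    ext x
    rw [← wordAct_tupleCode, h x x.2]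
    rfl
  · intro h x hx
    have := wordAct_tupleCode f w ⟨x, hx⟩
    rw [h] at this
    exact this

theorem isTupleCode_tupleCode (f : Fin k → Equiv.Perm (Fin n)) : IsTupleCode n (tupleCode f) := by
  refine fun i => ⟨by simp [tupleCode], fun x hx => ?_⟩
  rw [tupleCode, List.mem_ofFn]
  exact ⟨(f i)⁻¹ ⟨x, hx⟩, by simp⟩

theorem exists_perm_ofFn_eq {l : List ℕ} (hlen : l.length = n) (hmem : ∀ x < n, x ∈ l) :
    ∃ σ : Equiv.Perm (Fin n), (List.ofFn fun x => (σ x : ℕ)) = l := by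
  have hperm : (List.range n).Perm l :=
    ((List.nodup_range).subperm fun x hx => hmem x (List.mem_range.1 hx)).perm_of_length_le
      (by simp [hlen])
  have hlt : ∀ x : Fin n, l[(x : ℕ)]'(by omega) < n := fun x =>
    List.mem_range.1 (hperm.mem_iff.2 (List.getElem_mem _))
  have hinj : Function.Injective fun x : Fin n => (⟨l[(x : ℕ)]'(by omega), hlt x⟩ : Fin n) := by
    intro x y hxy
    have hnd : l.Nodup := hperm.nodup_iff.1 List.nodup_range
    exact Fin.ext ((hnd.getElem_inj_iff).1 (Fin.mk.inj hxy))
  refine ⟨Equiv.ofBijective _ (Finite.injective_iff_bijective.1 hinj), ?_⟩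
  apply List.ext_getElem
  · simp [hlen]
  · intro i _ _
    simp

theorem IsTupleCode.exists_eq {T : Fin k → List ℕ} (hT : IsTupleCode n T) :
    ∃ f : Fin k → Equiv.Perm (Fin n), tupleCode f = T := by
  choose f hf using fun i => exists_perm_ofFn_eq (hT i).1 (hT i).2
  exact ⟨f, funext hf⟩

theorem primrec_wordAct :
    Primrec fun a : ((Fin k → List ℕ) × List (Fin k × Bool)) × ℕ => wordAct a.1.1 a.1.2 a.2 := by
  have happ : Primrec fun a : (((Fin k → List ℕ) × List (Fin k × Bool)) × ℕ) ×
      ((Fin k × Bool) × ℕ) => a.1.1.1 a.2.1.1 :=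
    Primrec.fin_app.comp (Primrec.fst.comp (Primrec.fst.comp Primrec.fst))
      (Primrec.fst.comp (Primrec.fst.comp Primrec.snd))
  have hy : Primrec fun a : (((Fin k → List ℕ) × List (Fin k × Bool)) × ℕ) ×
      ((Fin k × Bool) × ℕ) => a.2.2 := Primrec.snd.comp Primrec.snd
  exact Primrec.list_foldr (Primrec.snd.comp Primrec.fst) Primrec.snd
    (Primrec.cond (Primrec.snd.comp (Primrec.fst.comp Primrec.snd))
      ((Primrec.list_getD 0).comp happ hy) (Primrec.list_idxOf.comp hy happ)).to₂

theorem primrecPred_kills {α : Type*} [Primcodable α] {N : α → ℕ} {T : α → Fin k → List ℕ}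
    {w : α → List (Fin k × Bool)} (hN : Primrec N) (hT : Primrec T) (hw : Primrec w) :
    PrimrecPred fun a => Kills (N a) (T a) (w a) :=
  primrecPred_forall_lt hN (P := fun x a => wordAct (T a) (w a) x = x)
    (Primrec.eq.comp (primrec_wordAct.comp
      (((hT.comp Primrec.snd).pair (hw.comp Primrec.snd)).pair Primrec.fst)) Primrec.fst)

theorem primrecPred_isTupleCode {α : Type*} [Primcodable α] {N : α → ℕ}
    {T : α → Fin k → List ℕ} (hN : Primrec N) (hT : Primrec T) :
    PrimrecPred fun a => IsTupleCode (N a) (T a) := by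
  have happ : Primrec fun a : Fin k × α => T a.2 a.1 :=
    Primrec.fin_app.comp (hT.comp Primrec.snd) Primrec.fst
  refine primrecPred_forall_fin (P := fun i a => (T a i).length = N a ∧ ∀ x < N a, x ∈ T a i) ?_
  refine PrimrecPred.and
    (Primrec.eq.comp (Primrec.list_length.comp happ) (hN.comp Primrec.snd)) ?_
  refine primrecPred_forall_lt (hN.comp Primrec.snd)
    (P := fun x (a : Fin k × α) => x ∈ T a.2 a.1) ?_
  exact (Primrec.nat_lt.comp (Primrec.list_idxOf.comp Primrec.fst (happ.comp Primrec.snd))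
    (Primrec.list_length.comp (happ.comp Primrec.snd))).of_eq fun a => List.idxOf_lt_length_iff

end TupleCodes

theorem primrecPred_nodup {α : Type*} [Primcodable α] :
    PrimrecPred fun l : List α => l.Nodup := by
  classical
  have h : PrimrecRel fun (i : ℕ) (l : List α) => (l[i]?).map (fun x => l.idxOf x) = some i :=
    Primrec.eq.comp
      (Primrec.option_map (Primrec.list_getElem?.comp Primrec.snd Primrec.fst)
        (Primrec.list_idxOf.comp Primrec.snd (Primrec.snd.comp Primrec.fst)).to₂)
      (Primrec.option_some.comp Primrec.fst)
  refine (primrecPred_forall_lt Primrec.list_length h).of_eq fun l => ?_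
  constructor
  · intro hl
    rw [List.nodup_iff_injective_getElem]
    intro i j hij
    have hi := hl i i.2
    have hj := hl j j.2
    simp only [Fin.is_lt, getElem?_pos, Option.map_some, Option.some.injEq] at hi hj
    exact Fin.ext (hi.symm.trans ((congrArg (fun x => l.idxOf x) hij).trans hj))
  · intro hl i hi
    simp [hi, hl.idxOf_getElem i hi]

section ExtensionCounting

variable {k : ℕ} {G : Type*} [Group G] {s : Fin k → G}

theorem extPred_iff (hs : Subgroup.closure (Set.range s) = ⊤) {n : ℕ}
    {f : Fin k → Equiv.Perm (Fin n)} :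
    ExtPred s ⟨n, f⟩ ↔ ∀ w, WordProb s w → FreeGroup.lift f (FreeGroup.mk w) = 1 := by
  constructor
  · rintro ⟨φ, hφ⟩ w hw
    have h : FreeGroup.lift f = φ.comp (FreeGroup.lift s) := by
      ext i : 1
      simpa using (hφ i).symm
    rw [h, MonoidHom.comp_apply, show FreeGroup.lift s (FreeGroup.mk w) = 1 from hw, map_one]
  · intro h
    have hsurj : Function.Surjective (FreeGroup.lift s) := by
      rw [← MonoidHom.range_eq_top, FreeGroup.range_lift_eq_closure, hs]
    have hker : (FreeGroup.lift s).ker ≤ (FreeGroup.lift f).ker := by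
      intro x hx
      induction x using Quot.inductionOn with
      | h w => exact h w hx
    refine ⟨(FreeGroup.lift s).liftOfSurjective hsurj ⟨FreeGroup.lift f, hker⟩, fun i => ?_⟩
    have := MonoidHom.liftOfRightInverse_comp_apply (FreeGroup.lift s) _
      (Function.rightInverse_surjInv hsurj) ⟨FreeGroup.lift f, hker⟩ (FreeGroup.of i)
    simpa using this

theorem exists_equiv_encode_eq_pair (k n : ℕ) :
    ∃ e : (Fin k → Equiv.Perm (Fin n)) ≃ Fin (n.factorial ^ k),
      ∀ f, encode (⟨n, f⟩ : Σ n : ℕ, Fin k → Equiv.Perm (Fin n)) = Nat.pair n (e f) :=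
  ⟨Fintype.equivFinOfCardEq (by simp [Fintype.card_perm]), fun _ => rfl⟩

theorem computable_card_not_extPred (hE : ComputablePred (ExtPred s)) :
    Computable fun n : ℕ => Nat.card {f : Fin k → Equiv.Perm (Fin n) // ¬ ExtPred s ⟨n, f⟩} := by
  classical
  let g : ℕ → ℕ → ℕ := fun n i =>
    Option.casesOn (decode (Nat.pair n i) : Option (Σ n : ℕ, Fin k → Equiv.Perm (Fin n))) 0
      fun x => cond (decide (ExtPred s x)) 0 1
  have hg : Computable₂ g :=
    Computable.option_casesOn
      (Computable.decode.comp (Primrec₂.natPair.to_comp.comp Computable.fst Computable.snd))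
      (Computable.const 0)
      (Computable.cond (hE.decide.comp Computable.snd) (Computable.const 0) (Computable.const 1))
  have hrec : Computable fun n : ℕ =>
      Nat.rec (motive := fun _ => ℕ) 0 (fun i acc => acc + g n i) (n.factorial ^ k) :=
    Computable.nat_rec ((primrec_pow_const k).comp primrec_factorial).to_comp (Computable.const 0)
      (Primrec.nat_add.to_comp.comp (Computable.snd.comp Computable.snd)
        (hg.comp Computable.fst (Computable.fst.comp Computable.snd))).to₂
  refine hrec.of_eq fun n => ?_
  have hsum : ∀ N : ℕ, Nat.rec (motive := fun _ => ℕ) 0 (fun i acc => acc + g n i) N =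
      ∑ i ∈ Finset.range N, g n i := by
    intro N
    induction N with
    | zero => rfl
    | succ N ih => rw [Finset.sum_range_succ, ← ih]
  obtain ⟨e, he⟩ := exists_equiv_encode_eq_pair k n
  have hval : ∀ f, g n (e f) = if ¬ ExtPred s ⟨n, f⟩ then 1 else 0 := by
    intro f
    simp only [g]
    rw [← he f, encodek]
    by_cases h : ExtPred s ⟨n, f⟩ <;> simp [h]
  rw [hsum, Finset.sum_range, ← e.sum_comp, Finset.sum_congr rfl fun f _ => hval f,
    ← Finset.card_filter, Nat.card_eq_fintype_card, Fintype.card_subtype]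

/-- A list of tables of pairwise distinct tuples, each with a relator that it violates. -/
def IsRefutationList (s : Fin k → G) (n : ℕ)
    (L : List ((Fin k → List ℕ) × List (Fin k × Bool))) : Prop :=
  (L.map Prod.fst).Nodup ∧
    ∀ p ∈ L, IsTupleCode n p.1 ∧ WordProb s p.2 ∧ ¬ Kills n p.1 p.2

theorem primrecPred_isRefutationList {α : Type*} [Primcodable α]
    (hW : PrimrecPred (WordProb s)) {N : α → ℕ}
    {L : α → List ((Fin k → List ℕ) × List (Fin k × Bool))} (hN : Primrec N) (hL : Primrec L) :
    PrimrecPred fun a => IsRefutationList s (N a) (L a) := by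
  refine PrimrecPred.and
    (primrecPred_nodup.comp (Primrec.list_map hL (Primrec.fst.comp Primrec.snd)))
    (primrecPred_forall_mem hL
      (P := fun p a => IsTupleCode (N a) p.1 ∧ WordProb s p.2 ∧ ¬ Kills (N a) p.1 p.2) ?_)
  have h1 : Primrec fun q : ((Fin k → List ℕ) × List (Fin k × Bool)) × α => q.1.1 :=
    Primrec.fst.comp Primrec.fst
  have h2 : Primrec fun q : ((Fin k → List ℕ) × List (Fin k × Bool)) × α => q.1.2 :=
    Primrec.snd.comp Primrec.fst
  exact (primrecPred_isTupleCode (hN.comp Primrec.snd) h1).and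
    ((hW.comp h2).and (primrecPred_kills (hN.comp Primrec.snd) h1 h2).not)

theorem IsRefutationList.exists_extends (hs : Subgroup.closure (Set.range s) = ⊤) {n : ℕ}
    {L : List ((Fin k → List ℕ) × List (Fin k × Bool))} (hL : IsRefutationList s n L)
    (hcard : L.length = Nat.card {f : Fin k → Equiv.Perm (Fin n) // ¬ ExtPred s ⟨n, f⟩})
    {f : Fin k → Equiv.Perm (Fin n)} (hf : tupleCode f ∉ L.map Prod.fst) :
    ExtPred s ⟨n, f⟩ := by
  classical
  by_contra hnot
  let C : Finset (Fin k → List ℕ) :=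
    (Finset.univ.filter fun f : Fin k → Equiv.Perm (Fin n) => ¬ ExtPred s ⟨n, f⟩).image tupleCode
  have hC : C.card = L.length := by
    rw [Finset.card_image_of_injective _ tupleCode_injective, hcard, Nat.card_eq_fintype_card,
      Fintype.card_subtype]
  have hsub : (L.map Prod.fst).toFinset ⊆ C := by
    intro T hT
    obtain ⟨p, hp, rfl⟩ := List.mem_map.1 (List.mem_toFinset.1 hT)
    obtain ⟨hcode, hw, hkill⟩ := hL.2 p hp
    obtain ⟨f', hf'⟩ := hcode.exists_eq
    refine Finset.mem_image.2 ⟨f', ?_, hf'⟩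
    simp only [Finset.mem_filter, Finset.mem_univ, true_and]
    intro hext
    rw [← hf', kills_tupleCode] at hkill
    exact hkill ((extPred_iff hs).1 hext _ hw)
  have heq : (L.map Prod.fst).toFinset = C :=
    Finset.eq_of_subset_of_card_le hsub (by rw [hC, List.toFinset_card_of_nodup hL.1]; simp)
  have hmem : tupleCode f ∈ C := Finset.mem_image.2 ⟨f, by simpa using hnot, rfl⟩
  rw [← heq, List.mem_toFinset] at hmem
  exact hf hmem

theorem exists_isRefutationList (hs : Subgroup.closure (Set.range s) = ⊤) (n : ℕ) :
    ∃ L, IsRefutationList s n L ∧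
      L.length = Nat.card {f : Fin k → Equiv.Perm (Fin n) // ¬ ExtPred s ⟨n, f⟩} ∧
      ∀ f : Fin k → Equiv.Perm (Fin n), ExtPred s ⟨n, f⟩ → tupleCode f ∉ L.map Prod.fst := by
  classical
  have hex : ∀ f : {f : Fin k → Equiv.Perm (Fin n) // ¬ ExtPred s ⟨n, f⟩},
      ∃ w, WordProb s w ∧ ¬ Kills n (tupleCode f.1) w := by
    rintro ⟨f, hf⟩
    rw [extPred_iff hs] at hf
    push Not at hf
    obtain ⟨w, hw, hne⟩ := hf
    exact ⟨w, hw, fun h => hne (kills_tupleCode.1 h)⟩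
  choose r hr using hex
  let L := (Finset.univ : Finset {f : Fin k → Equiv.Perm (Fin n) // ¬ ExtPred s ⟨n, f⟩}).toList.map
    fun f => (tupleCode f.1, r f)
  have hfst : L.map Prod.fst = (Finset.univ : Finset {f : Fin k → Equiv.Perm (Fin n) //
      ¬ ExtPred s ⟨n, f⟩}).toList.map fun f => tupleCode f.1 := by
    simp [L, Function.comp_def]
  refine ⟨L, ⟨?_, ?_⟩, ?_, ?_⟩
  · rw [hfst]
    exact (Finset.nodup_toList _).map (tupleCode_injective.comp Subtype.val_injective)
  · intro p hp
    obtain ⟨f, -, rfl⟩ := List.mem_map.1 hp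
    exact ⟨isTupleCode_tupleCode _, hr f⟩
  · simp [L]
  · intro f hf hmem
    rw [hfst] at hmem
    obtain ⟨f', -, hf'⟩ := List.mem_map.1 hmem
    exact f'.2 (tupleCode_injective hf' ▸ hf)

/-- If the finite quotients of a group with solvable word problem are computable for the given
numbering of tuples, then one can semi-decide whether some finite quotient kills one word but not
another. Only the number of extending tuples of each degree is extracted from the numbering. -/
theorem re_exists_extPred (hs : Subgroup.closure (Set.range s) = ⊤)
    (hW : PrimrecPred (WordProb s)) (hE : ComputablePred (ExtPred s))
    {α : Type*} [Primcodable α] {u v : α → List (Fin k × Bool)} (hu : Primrec u)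
    (hv : Primrec v) :
    REPred fun a => ∃ (n : ℕ) (f : Fin k → Equiv.Perm (Fin n)), ExtPred s ⟨n, f⟩ ∧
      FreeGroup.lift f (FreeGroup.mk (u a)) = 1 ∧ FreeGroup.lift f (FreeGroup.mk (v a)) ≠ 1 := by
  classical
  let B := (ℕ × (Fin k → List ℕ)) × List ((Fin k → List ℕ) × List (Fin k × Bool))
  let P : α → B → Prop := fun a b =>
    (IsTupleCode b.1.1 b.1.2 ∧ Kills b.1.1 b.1.2 (u a) ∧ ¬ Kills b.1.1 b.1.2 (v a) ∧
      IsRefutationList s b.1.1 b.2 ∧ ¬ (∃ T ∈ b.2.map Prod.fst, T = b.1.2)) ∧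
    b.2.length = Nat.card {f : Fin k → Equiv.Perm (Fin b.1.1) // ¬ ExtPred s ⟨b.1.1, f⟩}
  have hn : Primrec fun q : α × B => q.2.1.1 :=
    Primrec.fst.comp (Primrec.fst.comp Primrec.snd)
  have hT : Primrec fun q : α × B => q.2.1.2 :=
    Primrec.snd.comp (Primrec.fst.comp Primrec.snd)
  have hL : Primrec fun q : α × B => q.2.2 := Primrec.snd.comp Primrec.snd
  have hP : ComputablePred fun q : α × B => P q.1 q.2 := by
    refine computablePred_and (PrimrecPred.computablePred ?_) ?_
    · refine (primrecPred_isTupleCode hn hT).and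
        ((primrecPred_kills hn hT (hu.comp Primrec.fst)).and
        ((primrecPred_kills hn hT (hv.comp Primrec.fst)).not.and
        ((primrecPred_isRefutationList hW hn hL).and (PrimrecPred.not ?_))))
      exact PrimrecRel.comp (PrimrecRel.exists_mem_list Primrec.eq)
        (Primrec.list_map hL (Primrec.fst.comp Primrec.snd)) hT
    · exact ((Primrec.eq.decide.to_comp.comp (Primrec.list_length.comp hL).to_comp
        ((computable_card_not_extPred hE).comp hn.to_comp))).computablePred
  refine (re_exists_of_computablePred hP).of_eq fun a => ?_
  constructor
  · rintro ⟨⟨⟨n, T⟩, L⟩, ⟨hcode, hku, hkv, hR, hnot⟩, hcard⟩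
    obtain ⟨f, hf⟩ := hcode.exists_eq
    dsimp only at f hf hku hkv hR hnot hcard
    subst hf
    simp only [exists_eq_right] at hnot
    exact ⟨n, f, hR.exists_extends hs hcard hnot, kills_tupleCode.1 hku,
      fun h => hkv (kills_tupleCode.2 h)⟩
  · rintro ⟨n, f, hf, hfu, hfv⟩
    obtain ⟨L, hL, hcard, hnot⟩ := exists_isRefutationList hs n
    exact ⟨⟨⟨n, tupleCode f⟩, L⟩, ⟨isTupleCode_tupleCode f, kills_tupleCode.2 hfu,
      fun h => hfv (kills_tupleCode.1 h), hL, by simpa using hnot f hf⟩, hcard⟩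

end ExtensionCounting

section ForbiddenOffsets

open Nat.Partrec (Code)

/-- The program with number `k` halts on input `0` in exactly `m` steps. -/
def HaltsAt (k m : ℕ) : Prop :=
  Code.evaln m (Denumerable.ofNat Code k) 0 ≠ none ∧
    Code.evaln (m - 1) (Denumerable.ofNat Code k) 0 = none

theorem not_haltsAt_zero (k : ℕ) : ¬ HaltsAt k 0 := fun h => h.1 h.2

theorem HaltsAt.dom {k m : ℕ} (h : HaltsAt k m) :
    (Code.eval (Denumerable.ofNat Code k) 0).Dom := by
  obtain ⟨x, hx⟩ := Option.ne_none_iff_exists'.1 h.1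
  exact Part.dom_iff_mem.2 ⟨x, Code.evaln_sound hx⟩

theorem evaln_ne_none_mono {c : Code} {a b : ℕ} (hab : a ≤ b) (h : Code.evaln a c 0 ≠ none) :
    Code.evaln b c 0 ≠ none := by
  obtain ⟨x, hx⟩ := Option.ne_none_iff_exists'.1 h
  exact Option.ne_none_iff_exists'.2 ⟨x, Code.evaln_mono hab hx⟩

theorem HaltsAt.le {k m m' : ℕ} (h : HaltsAt k m) (h' : HaltsAt k m') : m ≤ m' := by
  by_contra hlt
  exact evaln_ne_none_mono (by omega) h'.1 h.2

theorem HaltsAt.unique {k m m' : ℕ} (h : HaltsAt k m) (h' : HaltsAt k m') : m = m' :=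
  le_antisymm (h.le h') (h'.le h)

theorem exists_haltsAt {k : ℕ} (h : (Code.eval (Denumerable.ofNat Code k) 0).Dom) :
    ∃ m, HaltsAt k m := by
  classical
  have hex : ∃ m, Code.evaln m (Denumerable.ofNat Code k) 0 ≠ none := by
    obtain ⟨x, hx⟩ := Part.dom_iff_mem.1 h
    obtain ⟨m, hm⟩ := Code.evaln_complete.1 hx
    exact ⟨m, Option.ne_none_iff_exists'.2 ⟨x, hm⟩⟩
  refine ⟨Nat.find hex, Nat.find_spec hex, ?_⟩
  have hpos : Nat.find hex ≠ 0 := by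
    intro h0
    have := Nat.find_spec hex
    rw [h0] at this
    exact this (by simp [Code.evaln])
  by_contra hne
  exact Nat.find_min hex (by omega) hne

theorem primrecRel_haltsAt : PrimrecRel HaltsAt := by
  have hcode : Primrec fun p : ℕ × ℕ => Denumerable.ofNat Code p.1 :=
    (Primrec.ofNat Code).comp Primrec.fst
  have heval : ∀ {g : ℕ × ℕ → ℕ}, Primrec g →
      PrimrecPred fun p : ℕ × ℕ => Code.evaln (g p) (Denumerable.ofNat Code p.1) 0 = none :=
    fun hg => Primrec.eq.comp
      (Code.primrec_evaln.comp ((hg.pair hcode).pair (Primrec.const 0))) (Primrec.const none)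
  exact (heval Primrec.snd).not.and (heval (Primrec.pred.comp Primrec.snd))

/-- The offsets `j` for which the commutator of `t ^ j * a * t ^ (-j)` and `b` is a relator. -/
def Forbidden (j : ℤ) : Prop :=
  j = 0 ∨ ∃ k m, HaltsAt k m ∧ j.natAbs = 2 ^ k * (2 * m + 1)

theorem Forbidden.neg {j : ℤ} (h : Forbidden j) : Forbidden (-j) := by
  simpa [Forbidden] using h

theorem not_forbidden_one : ¬ Forbidden 1 := by
  rintro (h | ⟨k, m, h, hkm⟩)
  · exact one_ne_zero h
  · have hm : 2 * m + 1 = 1 := Nat.dvd_one.1 ⟨2 ^ k, by rw [mul_comm]; exact hkm⟩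
    obtain rfl : m = 0 := by omega
    exact not_haltsAt_zero k h

theorem two_pow_dvd_iff {j : ℤ} {k m : ℕ} (h : j.natAbs = 2 ^ k * (2 * m + 1)) (a : ℕ) :
    (2 : ℤ) ^ a ∣ j ↔ a ≤ k := by
  have : (2 : ℤ) ^ a ∣ j ↔ 2 ^ a ∣ j.natAbs := by
    rw [← Int.natAbs_dvd_natAbs, Int.natAbs_pow]
    rfl
  rw [this, h]
  constructor
  · intro hd
    have hc : Nat.Coprime (2 ^ a) (2 * m + 1) := Nat.Coprime.pow_left _ (by simp)
    exact (Nat.pow_dvd_pow_iff_le_right (by norm_num)).1 (hc.dvd_of_dvd_mul_right hd)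
  · exact fun ha => (pow_dvd_pow 2 ha).mul_right _

theorem intCast_eq_intCast_two_pow {N : ℕ} {x y : ℤ} :
    (x : ZMod (2 ^ N)) = y ↔ (2 : ℤ) ^ N ∣ y - x := by
  rw [ZMod.intCast_eq_intCast_iff_dvd_sub]
  simp

theorem exists_haltsAt_of_forbidden {N k m : ℕ} {s j : ℤ} (hN : k + 1 ≤ N)
    (hj : j.natAbs = 2 ^ k * (2 * m + 1)) (hs : Forbidden s) (h : (s : ZMod (2 ^ N)) = j) :
    ∃ m', HaltsAt k m' ∧ s.natAbs = 2 ^ k * (2 * m' + 1) := by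
  have hdvd : ∀ a ≤ k + 1, (2 : ℤ) ^ a ∣ s ↔ (2 : ℤ) ^ a ∣ j := fun a ha =>
    (dvd_iff_dvd_of_dvd_sub
      ((pow_dvd_pow 2 (ha.trans hN)).trans (intCast_eq_intCast_two_pow.1 h))).symm
  rcases hs with rfl | ⟨k', m', hh, hs⟩
  · have := (two_pow_dvd_iff hj (k + 1)).1 ((hdvd (k + 1) le_rfl).1 (dvd_zero _))
    omega
  · have h1 : k ≤ k' := (two_pow_dvd_iff hs k).1
      ((hdvd k (by omega)).2 ((two_pow_dvd_iff hj k).2 le_rfl))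
    have h2 : ¬ k + 1 ≤ k' := fun hle => by
      have := (two_pow_dvd_iff hj (k + 1)).1
        ((hdvd (k + 1) le_rfl).1 ((two_pow_dvd_iff hs (k + 1)).2 hle))
      omega
    obtain rfl : k = k' := by omega
    exact ⟨m', hh, hs⟩

open Filter in
theorem eventually_intCast_eq_iff (x y : ℤ) :
    ∀ᶠ N : ℕ in atTop, ((x : ZMod (2 ^ N)) = y ↔ x = y) := by
  filter_upwards [eventually_ge_atTop (y - x).natAbs] with N hN
  rw [intCast_eq_intCast_two_pow]
  constructor
  · intro h
    have hlt : (y - x).natAbs < 2 ^ N := hN.trans_lt Nat.lt_two_pow_self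
    have hz : y - x = 0 := by
      refine Int.eq_zero_of_dvd_of_natAbs_lt_natAbs h ?_
      simpa [Int.natAbs_pow] using hlt
    omega
  · rintro rfl
    simp

/-- The residue class `r` modulo `2 ^ N` contains no forbidden offset. -/
def IsGood (N : ℕ) (r : ZMod (2 ^ N)) : Prop :=
  ∀ j : ℤ, Forbidden j → (j : ZMod (2 ^ N)) ≠ r

open Filter in
theorem eventually_isGood {j : ℤ} (hj : ¬ Forbidden j) : ∀ᶠ N in atTop, IsGood N j := by
  have hj0 : j.natAbs ≠ 0 := fun h => hj (Or.inl (Int.natAbs_eq_zero.1 h))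
  obtain ⟨k, q, ⟨m, rfl⟩, hkm⟩ := Nat.exists_eq_two_pow_mul_odd hj0
  by_cases hex : ∃ m', HaltsAt k m'
  · obtain ⟨m', hm'⟩ := hex
    set z : ℤ := 2 ^ k * (2 * m' + 1) with hz
    have hzabs : z.natAbs = 2 ^ k * (2 * m' + 1) := by
      rw [hz, Int.natAbs_mul, Int.natAbs_pow]
      rfl
    have hzF : Forbidden z := Or.inr ⟨k, m', hm', hzabs⟩
    filter_upwards [eventually_ge_atTop (k + 1), eventually_intCast_eq_iff z j,
      eventually_intCast_eq_iff (-z) j] with N hN h1 h2 s hs hsj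
    obtain ⟨m'', hh, hsabs⟩ := exists_haltsAt_of_forbidden hN hkm hs hsj
    obtain rfl := hm'.unique hh
    rcases Int.natAbs_eq_natAbs_iff.1 (hsabs.trans hzabs.symm) with rfl | rfl
    · exact hj (h1.1 hsj ▸ hzF)
    · exact hj (h2.1 hsj ▸ hzF.neg)
  · filter_upwards [eventually_ge_atTop (k + 1)] with N hN s hs hsj
    obtain ⟨m', hh, -⟩ := exists_haltsAt_of_forbidden hN hkm hs hsj
    exact hex ⟨m', hh⟩

/-- The integer represented by a pair of natural numbers. -/
def toInt (x : ℕ × ℕ) : ℤ := x.1 - x.2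

theorem primrec_two_pow : Primrec fun k : ℕ => 2 ^ k := by
  have h : Primrec fun k : ℕ => Nat.rec (motive := fun _ => ℕ) 1 (fun _ y => y * 2) k :=
    Primrec.nat_rec₁ 1 (Primrec.nat_mul.comp Primrec.snd (Primrec.const 2)).to₂
  refine h.of_eq fun k => ?_
  induction k with
  | zero => rfl
  | succ k ih => rw [pow_succ, ← ih]

theorem forbidden_toInt_iff (x : ℕ × ℕ) :
    Forbidden (toInt x) ↔ x.1 = x.2 ∨
      ¬ ∀ k < x.1 + x.2, ∀ m < x.1 + x.2,
        ¬ (HaltsAt k m ∧ (x.1 - x.2) + (x.2 - x.1) = 2 ^ k * (2 * m + 1)) := by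
  have habs : (toInt x).natAbs = (x.1 - x.2) + (x.2 - x.1) := by
    unfold toInt
    omega
  unfold Forbidden
  rw [habs]
  refine or_congr (by unfold toInt; omega) ?_
  push Not
  constructor
  · rintro ⟨k, m, h, he⟩
    have h1 : k < 2 ^ k := Nat.lt_two_pow_self
    have h2 : 2 ^ k ≤ 2 ^ k * (2 * m + 1) := Nat.le_mul_of_pos_right _ (by omega)
    have h3 : 2 * m + 1 ≤ 2 ^ k * (2 * m + 1) := Nat.le_mul_of_pos_left _ (by positivity)
    exact ⟨k, by omega, m, by omega, h, he⟩
  · rintro ⟨k, -, m, -, h⟩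
    exact ⟨k, m, h⟩

theorem primrecPred_forbidden : PrimrecPred fun x => Forbidden (toInt x) := by
  have hsum : Primrec fun x : ℕ × ℕ => x.1 + x.2 := Primrec.nat_add.comp Primrec.fst Primrec.snd
  have habs : Primrec fun x : ℕ × ℕ => (x.1 - x.2) + (x.2 - x.1) :=
    Primrec.nat_add.comp (Primrec.nat_sub.comp Primrec.fst Primrec.snd)
      (Primrec.nat_sub.comp Primrec.snd Primrec.fst)
  have hval : Primrec fun q : ℕ × ℕ × (ℕ × ℕ) => 2 ^ q.2.1 * (2 * q.1 + 1) :=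
    Primrec.nat_mul.comp (primrec_two_pow.comp (Primrec.fst.comp Primrec.snd))
      (Primrec.succ.comp (Primrec.nat_mul.comp (Primrec.const 2) Primrec.fst))
  refine PrimrecPred.of_eq (PrimrecPred.or (Primrec.eq.comp Primrec.fst Primrec.snd)
    (PrimrecPred.not (primrecPred_forall_lt hsum (P := fun k (x : ℕ × ℕ) =>
      ∀ m < x.1 + x.2, ¬ (HaltsAt k m ∧ (x.1 - x.2) + (x.2 - x.1) = 2 ^ k * (2 * m + 1))) ?_)))
    fun x => (forbidden_toInt_iff x).symm
  refine primrecPred_forall_lt (hsum.comp Primrec.snd) (P := fun m (q : ℕ × (ℕ × ℕ)) =>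
    ¬ (HaltsAt q.1 m ∧ (q.2.1 - q.2.2) + (q.2.2 - q.2.1) = 2 ^ q.1 * (2 * m + 1))) ?_
  exact ((primrecRel_haltsAt.comp (Primrec.fst.comp Primrec.snd) Primrec.fst).and
    (Primrec.eq.comp (habs.comp (Primrec.snd.comp Primrec.snd)) hval)).not

end ForbiddenOffsets

section Traces

/-- The number of entries of `l` satisfying `P`, modulo `2`. -/
noncomputable def parity (l : List (ℕ × ℕ)) (P : ℤ → Prop) : ZMod 2 :=
  open scoped Classical in (l.map fun x => if P (toInt x) then (1 : ZMod 2) else 0).sum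

@[simp]
theorem parity_nil (P : ℤ → Prop) : parity [] P = 0 := by
  simp [parity]

open scoped Classical in
theorem parity_cons (x : ℕ × ℕ) (l : List (ℕ × ℕ)) (P : ℤ → Prop) :
    parity (x :: l) P = (if P (toInt x) then 1 else 0) + parity l P := by
  simp [parity]

theorem parity_append (l l' : List (ℕ × ℕ)) (P : ℤ → Prop) :
    parity (l ++ l') P = parity l P + parity l' P := by
  simp [parity]

theorem parity_congr {l : List (ℕ × ℕ)} {P Q : ℤ → Prop}
    (h : ∀ x ∈ l, P (toInt x) ↔ Q (toInt x)) : parity l P = parity l Q := by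
  classical
  unfold parity
  congr 1
  exact List.map_congr_left fun x hx => by simp [h x hx]

theorem parity_eq_sum_fibers {l : List (ℕ × ℕ)} {P : ℤ → Prop} {J : Finset ℤ}
    (h : ∀ x ∈ l, P (toInt x) ↔ toInt x ∈ J) :
    parity l P = ∑ j ∈ J, parity l (· = j) := by
  classical
  induction l with
  | nil => simp
  | cons x l ih =>
    simp only [parity_cons, Finset.sum_add_distrib]
    rw [ih fun y hy => h y (List.mem_cons_of_mem _ hy)]
    simp only [h x List.mem_cons_self, add_left_inj]
    convert (Finset.sum_ite_eq J (toInt x) fun _ => (1 : ZMod 2)).symm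

theorem parity_eq_zero_of_fibers {l : List (ℕ × ℕ)} {P : ℤ → Prop}
    (h : ∀ j, P j → parity l (· = j) = 0) : parity l P = 0 := by
  classical
  rw [parity_eq_sum_fibers (J := (l.map toInt).toFinset.filter P)]
  · exact Finset.sum_eq_zero fun j hj => h j (Finset.mem_filter.1 hj).2
  · intro x hx
    simp only [Finset.mem_filter, List.mem_toFinset, List.mem_map]
    exact ⟨fun hP => ⟨⟨x, hx, rfl⟩, hP⟩, fun hP => hP.2⟩

open Filter in
theorem eventually_parity_intCast_eq (l : List (ℕ × ℕ)) (j : ℤ) :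
    ∀ᶠ N : ℕ in atTop,
      parity l (fun i => (i : ZMod (2 ^ N)) = j) = parity l (· = j) := by
  have h : ∀ᶠ N : ℕ in atTop, ∀ x ∈ l, ((toInt x : ZMod (2 ^ N)) = j ↔ toInt x = j) := by
    induction l with
    | nil => simp
    | cons x l ih =>
      filter_upwards [ih, eventually_intCast_eq_iff (toInt x) j] with N h1 h2
      exact List.forall_mem_cons.2 ⟨h2, h1⟩
  exact h.mono fun N hN => parity_congr hN

theorem sum_map_eq_sum_parity {n : ℕ} [NeZero n] (g : ZMod n → ZMod 2) (l : List (ℕ × ℕ)) :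
    (l.map fun x => g (toInt x)).sum =
      ∑ y, g y * parity l (fun i => (i : ZMod n) = y) := by
  classical
  induction l with
  | nil => simp
  | cons x l ih => simp [parity_cons, mul_add, Finset.sum_add_distrib, ih]

theorem parity_eq_natCast_length (l : List (ℕ × ℕ)) (x : ℕ × ℕ) :
    parity l (· = toInt x) =
      ((l.filter fun y => y.1 + x.2 = x.1 + y.2).length : ZMod 2) := by
  classical
  induction l with
  | nil => simp
  | cons y l ih =>
    have hiff : toInt y = toInt x ↔ y.1 + x.2 = x.1 + y.2 := by
      unfold toInt
      omega
    rw [parity_cons, ih, List.filter_cons]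
    by_cases h : y.1 + x.2 = x.1 + y.2
    · simp [hiff, h, add_comm]
    · simp [hiff, h]

theorem forall_parity_eq_zero_iff (l : List (ℕ × ℕ)) (Q : ℤ → Prop) :
    (∀ j, Q j → parity l (· = j) = 0) ↔
      ∀ x ∈ l, ¬ Q (toInt x) ∨ (l.filter fun y => y.1 + x.2 = x.1 + y.2).length % 2 = 0 := by
  have hx : ∀ x, parity l (· = toInt x) = 0 ↔
      (l.filter fun y => y.1 + x.2 = x.1 + y.2).length % 2 = 0 := fun x => by
    rw [parity_eq_natCast_length, ZMod.natCast_eq_zero_iff, Nat.dvd_iff_mod_eq_zero]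
  constructor
  · exact fun h x _ => or_iff_not_imp_left.2 fun hQ => (hx x).1 (h _ (not_not.1 hQ))
  · intro h j hj
    by_cases hmem : ∃ x ∈ l, toInt x = j
    · obtain ⟨x, hxl, rfl⟩ := hmem
      exact (hx x).2 ((h x hxl).resolve_left (not_not.2 hj))
    · have : parity l (· = j) = parity l fun _ => False :=
        parity_congr fun x hxl => iff_false_intro fun he => hmem ⟨x, hxl, he⟩
      rw [this]
      simp [parity]

/-- The record of the walk described by a word: the final position, the positions of the letters
`a`, the positions of the letters `b`, and the offsets from each `b` to the earlier letters `a`. -/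
abbrev Trace : Type := (ℕ × ℕ) × List (ℕ × ℕ) × List (ℕ × ℕ) × List (ℕ × ℕ)

/-- The effect of reading one letter; the generators `0`, `1`, `2` are `a`, `b`, `t`. -/
def traceStep (l : Fin 3 × Bool) (τ : Trace) : Trace :=
  if l.1 = 0 then (τ.1, τ.1 :: τ.2.1, τ.2.2)
  else if l.1 = 1 then
    (τ.1, τ.2.1, τ.1 :: τ.2.2.1,
      τ.2.1.map (fun x => (x.1 + τ.1.2, x.2 + τ.1.1)) ++ τ.2.2.2)
  else (cond l.2 (τ.1.1 + 1, τ.1.2) (τ.1.1, τ.1.2 + 1), τ.2)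

/-- The trace of a word, read from right to left. -/
def trace (w : List (Fin 3 × Bool)) : Trace :=
  w.foldr traceStep ((0, 0), [], [], [])

theorem primrec_traceStep : Primrec₂ traceStep := by
  have hpos : Primrec fun q : (Fin 3 × Bool) × Trace => q.2.1 := Primrec.fst.comp Primrec.snd
  have has : Primrec fun q : (Fin 3 × Bool) × Trace => q.2.2.1 :=
    Primrec.fst.comp (Primrec.snd.comp Primrec.snd)
  have hrest : Primrec fun q : (Fin 3 × Bool) × Trace => q.2.2.2 :=
    Primrec.snd.comp (Primrec.snd.comp Primrec.snd)
  have hgen : ∀ i, PrimrecPred fun q : (Fin 3 × Bool) × Trace => q.1.1 = i := fun i =>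
    Primrec.eq.comp (Primrec.fst.comp Primrec.fst) (Primrec.const i)
  have hp1 : Primrec fun q : (Fin 3 × Bool) × Trace => q.2.1.1 := Primrec.fst.comp hpos
  have hp2 : Primrec fun q : (Fin 3 × Bool) × Trace => q.2.1.2 := Primrec.snd.comp hpos
  have hshift : Primrec₂ fun (q : (Fin 3 × Bool) × Trace) (x : ℕ × ℕ) =>
      (x.1 + q.2.1.2, x.2 + q.2.1.1) :=
    (Primrec.pair
      (Primrec.nat_add.comp (Primrec.fst.comp Primrec.snd) (hp2.comp Primrec.fst))
      (Primrec.nat_add.comp (Primrec.snd.comp Primrec.snd) (hp1.comp Primrec.fst))).to₂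
  refine Primrec.ite (hgen 0) (hpos.pair ((Primrec.list_cons.comp hpos has).pair hrest))
    (Primrec.ite (hgen 1) (hpos.pair (has.pair (Primrec.pair
      (Primrec.list_cons.comp hpos (Primrec.fst.comp hrest))
      (Primrec.list_append.comp (Primrec.list_map has hshift) (Primrec.snd.comp hrest)))))
    (Primrec.pair ?_ (Primrec.snd.comp Primrec.snd)))
  exact Primrec.cond (Primrec.snd.comp Primrec.fst) ((Primrec.succ.comp hp1).pair hp2)
    (hp1.pair (Primrec.succ.comp hp2))

theorem primrec_trace : Primrec trace :=
  Primrec.list_foldr Primrec.id (Primrec.const _)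
    (primrec_traceStep.comp (Primrec.fst.comp Primrec.snd) (Primrec.snd.comp Primrec.snd)).to₂

/-- The combinatorial criterion for a word to be trivial. -/
def IsNull (τ : Trace) : Prop :=
  toInt τ.1 = 0 ∧ (∀ j, True → parity τ.2.1 (· = j) = 0) ∧
    (∀ j, True → parity τ.2.2.1 (· = j) = 0) ∧
    ∀ j, ¬ Forbidden j → parity τ.2.2.2 (· = j) = 0

theorem primrecPred_forall_parity {Q : ℤ → Prop} (hQ : PrimrecPred fun x => Q (toInt x)) :
    PrimrecPred fun l : List (ℕ × ℕ) => ∀ j, Q j → parity l (· = j) = 0 := by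
  have hR : PrimrecRel fun y x : ℕ × ℕ => y.1 + x.2 = x.1 + y.2 :=
    Primrec.eq.comp
      (Primrec.nat_add.comp (Primrec.fst.comp Primrec.fst) (Primrec.snd.comp Primrec.snd))
      (Primrec.nat_add.comp (Primrec.fst.comp Primrec.snd) (Primrec.snd.comp Primrec.fst))
  refine PrimrecPred.of_eq (primrecPred_forall_mem Primrec.id (P := fun x (l : List (ℕ × ℕ)) =>
    ¬ Q (toInt x) ∨ (l.filter fun y => y.1 + x.2 = x.1 + y.2).length % 2 = 0) ?_)
    fun l => (forall_parity_eq_zero_iff l Q).symm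
  exact (hQ.comp Primrec.fst).not.or (Primrec.eq.comp
    (Primrec.nat_mod.comp (Primrec.list_length.comp
      (hR.listFilter.comp Primrec.snd Primrec.fst)) (Primrec.const 2)) (Primrec.const 0))

theorem primrecPred_isNull : PrimrecPred IsNull := by
  have htrue : PrimrecPred fun _ : ℕ × ℕ => True :=
    (Primrec.eq.comp (Primrec.const 0) (Primrec.const 0)).of_eq fun _ => by simp
  have hrest : Primrec fun τ : Trace => τ.2.2 := Primrec.snd.comp Primrec.snd
  refine PrimrecPred.and ?_ (PrimrecPred.and
    ((primrecPred_forall_parity htrue).comp (Primrec.fst.comp Primrec.snd)) (PrimrecPred.and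
    ((primrecPred_forall_parity htrue).comp (Primrec.fst.comp hrest))
    ((primrecPred_forall_parity primrecPred_forbidden.not).comp (Primrec.snd.comp hrest))))
  exact (Primrec.eq.comp (Primrec.fst.comp Primrec.fst) (Primrec.snd.comp Primrec.fst)).of_eq
    fun τ => by
      unfold toInt
      omega

end Traces

section Lamps

variable (n : ℕ)

/-- The states of a cyclic row of `n` lamps with a lamplighter and a one-bit register. -/
abbrev LampState : Type := (ZMod n → ZMod 2) × ZMod n × ZMod 2

/-- The lamplighter toggles the lamp at the current position. -/
def toggle : Equiv.Perm (LampState n) :=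
  Function.Involutive.toPerm (fun x => (x.1 + Pi.single x.2.1 1, x.2)) fun x => by
    ext i <;> simp [add_assoc, CharTwo.add_self_eq_zero]

/-- The lamplighter adds the lamp at offset `r` to the register. -/
def readLamp (r : ZMod n) : Equiv.Perm (LampState n) :=
  Function.Involutive.toPerm (fun x => (x.1, x.2.1, x.2.2 + x.1 (x.2.1 + r))) fun x => by
    ext i <;> simp [add_assoc, CharTwo.add_self_eq_zero]

/-- The lamplighter moves by one step. -/
def move : Equiv.Perm (LampState n) where
  toFun x := (x.1, x.2.1 + 1, x.2.2)
  invFun x := (x.1, x.2.1 - 1, x.2.2)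
  left_inv x := by simp
  right_inv x := by simp

variable {n}

theorem toggle_apply (x : LampState n) : toggle n x = (x.1 + Pi.single x.2.1 1, x.2) := rfl

theorem readLamp_apply (r : ZMod n) (x : LampState n) :
    readLamp n r x = (x.1, x.2.1, x.2.2 + x.1 (x.2.1 + r)) := rfl

theorem move_apply (x : LampState n) : move n x = (x.1, x.2.1 + 1, x.2.2) := rfl

theorem move_inv_apply (x : LampState n) : (move n)⁻¹ x = (x.1, x.2.1 - 1, x.2.2) := rfl

theorem move_pow_apply (m : ℕ) (x : LampState n) :
    (move n ^ m) x = (x.1, x.2.1 + m, x.2.2) := by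
  induction m with
  | zero => simp
  | succ m ih =>
    rw [pow_succ', Equiv.Perm.mul_apply, ih, move_apply]
    simp [add_assoc]

theorem move_pow_inv_apply (m : ℕ) (x : LampState n) :
    (move n ^ m)⁻¹ x = (x.1, x.2.1 - m, x.2.2) := by
  rw [Equiv.Perm.inv_eq_iff_eq, move_pow_apply]
  simp

/-- The three lamplighter moves. -/
def lampGens (n : ℕ) (r : ZMod n) : Fin 3 → Equiv.Perm (LampState n) :=
  ![toggle n, readLamp n r, move n]

theorem toInt_shift (x p : ℕ × ℕ) : toInt (x.1 + p.2, x.2 + p.1) = toInt x - toInt p := by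
  simp only [toInt]
  push_cast
  ring

theorem sum_single_apply_offset (r : ZMod n) (p e : ZMod n) (l : List (ℕ × ℕ)) (q : ℕ × ℕ)
    (he : e = toInt q) :
    (l.map fun x => (Pi.single (p + (toInt x : ZMod n)) 1 : ZMod n → ZMod 2)).sum (p + e + r) =
      parity (l.map fun x => (x.1 + q.2, x.2 + q.1)) fun i => (i : ZMod n) = r := by
  classical
  induction l with
  | nil => simp
  | cons x l ih =>
    rw [List.map_cons, List.sum_cons, Pi.add_apply, ih, List.map_cons, parity_cons, toInt_shift,
      Pi.single_apply, he]
    congr 2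
    rw [add_assoc, add_right_inj, eq_comm, Int.cast_sub, sub_eq_iff_eq_add, add_comm, eq_iff_iff]
    exact eq_comm

theorem lift_lampGens_apply (r : ZMod n) (w : List (Fin 3 × Bool)) (f : ZMod n → ZMod 2)
    (p : ZMod n) (c : ZMod 2) :
    FreeGroup.lift (lampGens n r) (FreeGroup.mk w) (f, p, c) =
      (f + ((trace w).2.1.map fun x =>
          (Pi.single (p + (toInt x : ZMod n)) 1 : ZMod n → ZMod 2)).sum,
        p + (toInt (trace w).1 : ZMod n),
        c + ((trace w).2.2.1.map fun x => f (p + (toInt x : ZMod n) + r)).sum +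
          parity (trace w).2.2.2 fun i => (i : ZMod n) = r) := by
  induction w with
  | nil => simp [trace, toInt]
  | cons l w ih =>
    obtain ⟨i, b⟩ := l
    have htrace : trace ((i, b) :: w) = traceStep (i, b) (trace w) := rfl
    rw [FreeGroup.lift_mk] at ih ⊢
    rw [List.map_cons, List.prod_cons, Equiv.Perm.mul_apply, ih, htrace]
    fin_cases i
    · have : (cond b (lampGens n r 0) (lampGens n r 0)⁻¹) = toggle n := by cases b <;> rfl
      simp only [Fin.zero_eta, this, toggle_apply, traceStep, if_true, List.map_cons,
        List.sum_cons, Prod.mk.injEq, and_true]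
      abel
    · have : (cond b (lampGens n r 1) (lampGens n r 1)⁻¹) = readLamp n r := by cases b <;> rfl
      simp only [Fin.mk_one, this, readLamp_apply, traceStep, one_ne_zero, if_false, if_true,
        List.map_cons, List.sum_cons, Prod.mk.injEq, true_and, Pi.add_apply, parity_append,
        sum_single_apply_offset r p _ _ _ rfl]
      abel
    · cases b
      · have : (cond false (lampGens n r 2) (lampGens n r 2)⁻¹) = (move n)⁻¹ := rfl
        simp [this, move_inv_apply, traceStep, toInt]
        ring
      · have : (cond true (lampGens n r 2) (lampGens n r 2)⁻¹) = move n := rfl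
        simp [this, move_apply, traceStep, toInt]
        ring

theorem sum_single_eq_parity (p y : ZMod n) (l : List (ℕ × ℕ)) :
    (l.map fun x => (Pi.single (p + (toInt x : ZMod n)) 1 : ZMod n → ZMod 2)).sum y =
      parity l fun i => (i : ZMod n) = y - p := by
  classical
  induction l with
  | nil => simp
  | cons x l ih =>
    rw [List.map_cons, List.sum_cons, Pi.add_apply, ih, parity_cons, Pi.single_apply]
    congr 2
    rw [eq_sub_iff_add_eq, add_comm p]
    exact propext eq_comm

theorem lift_lampGens_eq_one_iff [NeZero n] (r : ZMod n) (w : List (Fin 3 × Bool)) :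
    FreeGroup.lift (lampGens n r) (FreeGroup.mk w) = 1 ↔
      (toInt (trace w).1 : ZMod n) = 0 ∧
      (∀ y, (parity (trace w).2.1 fun i => (i : ZMod n) = y) = 0) ∧
      (∀ y, (parity (trace w).2.2.1 fun i => (i : ZMod n) = y) = 0) ∧
      (parity (trace w).2.2.2 fun i => (i : ZMod n) = r) = 0 := by
  classical
  constructor
  · intro h
    have h0 := lift_lampGens_apply r w 0 0 0
    rw [h] at h0
    simp only [Equiv.Perm.coe_one, id_eq, Prod.mk.injEq, zero_add, Pi.zero_apply,
      List.map_const', List.sum_replicate, smul_zero] at h0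
    obtain ⟨hA, hp, hC⟩ := h0
    refine ⟨hp.symm, fun y => ?_, fun y => ?_, hC.symm⟩
    · have := sum_single_eq_parity 0 y (trace w).2.1
      simp only [zero_add, sub_zero] at this
      rw [← this, ← hA, Pi.zero_apply]
    · have h1 := congrArg (fun x => x.2.2) (lift_lampGens_apply r w (Pi.single (y + r) 1) 0 0)
      rw [h, ← hC] at h1
      simp only [Equiv.Perm.coe_one, id_eq, zero_add, add_zero, Pi.single_apply,
        add_left_inj] at h1
      unfold parity
      convert h1.symm
  · rintro ⟨hp, hA, hB, hC⟩
    ext1 ⟨f, p, c⟩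
    rw [lift_lampGens_apply, hC, hp]
    have hf : ((trace w).2.1.map fun x =>
        (Pi.single (p + (toInt x : ZMod n)) 1 : ZMod n → ZMod 2)).sum = 0 := by
      funext y
      rw [sum_single_eq_parity, hA, Pi.zero_apply]
    rw [hf, sum_map_eq_sum_parity fun q => f (p + q + r)]
    simp [hB]

end Lamps

section MarkedGroup

open Filter

/-- The words that act trivially on every lamp row whose offset is good. -/
def lampRelators : Subgroup (FreeGroup (Fin 3)) :=
  ⨅ q : Σ N : ℕ, {r : ZMod (2 ^ N) // IsGood N r},
    (FreeGroup.lift (lampGens (2 ^ q.1) q.2.1)).ker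

theorem mem_lampRelators {x : FreeGroup (Fin 3)} :
    x ∈ lampRelators ↔
      ∀ (N : ℕ) (r : ZMod (2 ^ N)), IsGood N r → FreeGroup.lift (lampGens (2 ^ N) r) x = 1 := by
  simp only [lampRelators, Subgroup.mem_iInf, MonoidHom.mem_ker]
  exact ⟨fun h N r hr => h ⟨N, r, hr⟩, fun h q => h q.1 q.2.1 q.2.2⟩

instance normal_lampRelators : lampRelators.Normal :=
  Subgroup.normal_iInf_normal fun _ => inferInstance

/-- The group generated by the lamplighter moves on all good lamp rows. -/
abbrev LampGroup : Type := FreeGroup (Fin 3) ⧸ lampRelators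

/-- The marking of the lamp group. -/
def lampMarking (i : Fin 3) : LampGroup := QuotientGroup.mk (FreeGroup.of i)

theorem lift_lampMarking : FreeGroup.lift lampMarking = QuotientGroup.mk' lampRelators :=
  FreeGroup.ext_hom _ _ fun i => by simp [lampMarking]

theorem closure_range_lampMarking : Subgroup.closure (Set.range lampMarking) = ⊤ := by
  rw [← FreeGroup.range_lift_eq_closure, lift_lampMarking, MonoidHom.range_eq_top]
  exact QuotientGroup.mk'_surjective _

theorem lift_lampMarking_eq_one_iff {x : FreeGroup (Fin 3)} :
    FreeGroup.lift lampMarking x = 1 ↔ x ∈ lampRelators := by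
  rw [lift_lampMarking, QuotientGroup.mk'_apply, QuotientGroup.eq_one_iff]

theorem mk_mem_lampRelators_iff (w : List (Fin 3 × Bool)) :
    FreeGroup.mk w ∈ lampRelators ↔ IsNull (trace w) := by
  rw [mem_lampRelators]
  constructor
  · intro h
    have key : ∀ j : ℤ, ¬ Forbidden j → ∀ᶠ N : ℕ in atTop,
        FreeGroup.lift (lampGens (2 ^ N) (j : ZMod (2 ^ N))) (FreeGroup.mk w) = 1 := fun j hj =>
      (eventually_isGood hj).mono fun N hN => h N _ hN
    refine ⟨?_, fun j _ => ?_, fun j _ => ?_, fun j hj => ?_⟩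
    · obtain ⟨N, h1, h2⟩ := ((key 1 not_forbidden_one).and
        (eventually_intCast_eq_iff (toInt (trace w).1) 0)).exists
      exact h2.1 (by simpa using ((lift_lampGens_eq_one_iff _ _).1 h1).1)
    · obtain ⟨N, h1, h2⟩ := ((key 1 not_forbidden_one).and
        (eventually_parity_intCast_eq (trace w).2.1 j)).exists
      exact h2.symm.trans (((lift_lampGens_eq_one_iff _ _).1 h1).2.1 _)
    · obtain ⟨N, h1, h2⟩ := ((key 1 not_forbidden_one).and
        (eventually_parity_intCast_eq (trace w).2.2.1 j)).exists
      exact h2.symm.trans (((lift_lampGens_eq_one_iff _ _).1 h1).2.2.1 _)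
    · obtain ⟨N, h1, h2⟩ := ((key j hj).and
        (eventually_parity_intCast_eq (trace w).2.2.2 j)).exists
      exact h2.symm.trans ((lift_lampGens_eq_one_iff _ _).1 h1).2.2.2
  · rintro ⟨hp, hA, hB, hC⟩ N r hr
    rw [lift_lampGens_eq_one_iff, hp]
    exact ⟨by simp, fun y => parity_eq_zero_of_fibers fun j _ => hA j trivial,
      fun y => parity_eq_zero_of_fibers fun j _ => hB j trivial,
      parity_eq_zero_of_fibers fun j hj => hC j fun hF => hr j hF hj⟩

theorem primrecPred_wordProb_lampMarking : PrimrecPred (WordProb lampMarking) :=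
  (primrecPred_isNull.comp primrec_trace).of_eq fun w =>
    ((lift_lampMarking_eq_one_iff).trans (mk_mem_lampRelators_iff w)).symm

/-- The finite quotient of the lamp group acting on one good lamp row. -/
def lampAction {N : ℕ} {r : ZMod (2 ^ N)} (hr : IsGood N r) :
    LampGroup →* Equiv.Perm (LampState (2 ^ N)) :=
  QuotientGroup.lift lampRelators (FreeGroup.lift (lampGens (2 ^ N) r))
    fun _ hx => mem_lampRelators.1 hx N r hr

/-- The action on one good lamp row, as permutations of an initial segment. -/
noncomputable def lampFinAction {N : ℕ} {r : ZMod (2 ^ N)} (hr : IsGood N r) :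
    LampGroup →* Equiv.Perm (Fin (Fintype.card (LampState (2 ^ N)))) :=
  ((Fintype.equivFin (LampState (2 ^ N))).permCongrHom.toMonoidHom).comp (lampAction hr)

theorem lampFinAction_mk_eq_one_iff {N : ℕ} {r : ZMod (2 ^ N)} (hr : IsGood N r)
    (x : FreeGroup (Fin 3)) :
    lampFinAction hr (x : LampGroup) = 1 ↔ FreeGroup.lift (lampGens (2 ^ N) r) x = 1 :=
  map_eq_one_iff _ (Fintype.equivFin (LampState (2 ^ N))).permCongrHom.injective

theorem residuallyFinite_lampGroup : ResiduallyFinite LampGroup := by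
  intro g hg
  obtain ⟨x, rfl⟩ := QuotientGroup.mk_surjective g
  rw [Ne, QuotientGroup.eq_one_iff, mem_lampRelators] at hg
  push Not at hg
  obtain ⟨N, r, hr, hx⟩ := hg
  exact ⟨_, lampFinAction hr, fun h => hx ((lampFinAction_mk_eq_one_iff hr x).1 h)⟩

/-- The word `t ^ (2 ^ k)`. -/
def moveWord (k : ℕ) : List (Fin 3 × Bool) :=
  Nat.rec (motive := fun _ => List (Fin 3 × Bool)) [(2, true)] (fun _ w => w ++ w) k

theorem primrec_moveWord : Primrec moveWord :=
  Primrec.nat_rec₁ _ (Primrec.list_append.comp Primrec.snd Primrec.snd).to₂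

theorem mk_moveWord (k : ℕ) : FreeGroup.mk (moveWord k) = FreeGroup.of 2 ^ 2 ^ k := by
  induction k with
  | zero => simp [moveWord, FreeGroup.of]
  | succ k ih =>
    have : moveWord (k + 1) = moveWord k ++ moveWord k := rfl
    rw [this, ← FreeGroup.mul_mk, ih, ← pow_add, pow_succ, mul_two]

/-- The word `t ^ (2 ^ k) * a * t ^ (2 ^ k) * b`. -/
def halfProbeWord (k : ℕ) : List (Fin 3 × Bool) :=
  (moveWord k ++ [(0, true)]) ++ (moveWord k ++ [(1, true)])

/-- The square of the word `t ^ (2 ^ k) * a * t ^ (2 ^ k) * b`. -/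
def probeWord (k : ℕ) : List (Fin 3 × Bool) := halfProbeWord k ++ halfProbeWord k

theorem primrec_probeWord : Primrec probeWord := by
  have h : Primrec halfProbeWord := Primrec.list_append.comp
    (Primrec.list_append.comp primrec_moveWord (Primrec.const _))
    (Primrec.list_append.comp primrec_moveWord (Primrec.const _))
  exact Primrec.list_append.comp h h

theorem mk_probeWord (k : ℕ) :
    FreeGroup.mk (probeWord k) = (FreeGroup.of 2 ^ 2 ^ k * FreeGroup.of 0 *
      FreeGroup.of 2 ^ 2 ^ k * FreeGroup.of 1) ^ 2 := by
  simp only [probeWord, halfProbeWord, ← FreeGroup.mul_mk, mk_moveWord, pow_two]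
  simp only [FreeGroup.of, mul_assoc]

theorem commutator_mem_lampRelators {m : ℕ} (hm : Forbidden m) :
    (FreeGroup.of 2 ^ m * FreeGroup.of 0 * (FreeGroup.of 2 ^ m)⁻¹ * FreeGroup.of 1) ^ 2 ∈
      lampRelators := by
  rw [mem_lampRelators]
  intro N r hr
  have hne : (-(m : ZMod (2 ^ N))) ≠ r := by simpa using hr _ hm.neg
  have h0 : lampGens (2 ^ N) r 0 = toggle _ := rfl
  have h1 : lampGens (2 ^ N) r 1 = readLamp _ r := rfl
  have h2 : lampGens (2 ^ N) r 2 = move _ := rfl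
  simp only [map_pow, map_mul, map_inv, FreeGroup.lift_apply_of, h0, h1, h2]
  ext1 ⟨f, p, c⟩
  have hp : p + r ≠ p - m := fun h => hne (by linear_combination -h)
  simp only [pow_two, Equiv.Perm.mul_apply, readLamp_apply, move_pow_inv_apply, toggle_apply,
    move_pow_apply, sub_add_cancel, Pi.add_apply, Pi.single_apply, if_neg hp, add_zero, add_assoc,
    CharTwo.add_self_eq_zero, Equiv.Perm.one_apply]

theorem lift_eq_one_of_extPred {n : ℕ} {f : Fin 3 → Equiv.Perm (Fin n)}
    (h : ExtPred lampMarking ⟨n, f⟩) {x : FreeGroup (Fin 3)} (hx : x ∈ lampRelators) :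
    FreeGroup.lift f x = 1 := by
  obtain ⟨φ, hφ⟩ := h
  have : FreeGroup.lift f = φ.comp (FreeGroup.lift lampMarking) :=
    FreeGroup.ext_hom _ _ fun i => by simpa using (hφ i).symm
  rw [this, MonoidHom.comp_apply, lift_lampMarking_eq_one_iff.2 hx, map_one]

theorem lift_probeWord_eq_one {n k m : ℕ} {f : Fin 3 → Equiv.Perm (Fin n)}
    (h : ExtPred lampMarking ⟨n, f⟩) (hkm : HaltsAt k m)
    (hu : FreeGroup.lift f (FreeGroup.mk (moveWord (k + 1))) = 1) :
    FreeGroup.lift f (FreeGroup.mk (probeWord k)) = 1 := by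
  have hF : Forbidden ((2 ^ k * (2 * m + 1) : ℕ) : ℤ) := Or.inr ⟨k, m, hkm, Int.natAbs_natCast _⟩
  have hrel := lift_eq_one_of_extPred h (commutator_mem_lampRelators hF)
  rw [mk_moveWord] at hu
  rw [mk_probeWord]
  simp only [map_pow, map_mul, map_inv, FreeGroup.lift_apply_of] at hrel hu ⊢
  have hsq : f 2 ^ 2 ^ k * f 2 ^ 2 ^ k = 1 := by rw [← pow_add, ← mul_two, ← pow_succ, hu]
  have hpow : f 2 ^ (2 ^ k * (2 * m + 1)) = f 2 ^ 2 ^ k := by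
    rw [pow_mul, pow_succ, pow_mul, pow_two, hsq, one_pow, one_mul]
  rwa [hpow, inv_eq_of_mul_eq_one_right hsq] at hrel

theorem isGood_two_pow {k : ℕ} (h : ∀ m, ¬ HaltsAt k m) : IsGood (k + 1) (2 ^ k) := by
  intro j hj hjk
  obtain ⟨m, hm, -⟩ := exists_haltsAt_of_forbidden (k := k) (m := 0) (j := 2 ^ k) le_rfl
    (by simp [Int.natAbs_pow]) hj (by simpa using hjk)
  exact h m hm

theorem lift_lampGens_moveWord (k : ℕ) (r : ZMod (2 ^ (k + 1))) :
    FreeGroup.lift (lampGens (2 ^ (k + 1)) r) (FreeGroup.mk (moveWord (k + 1))) = 1 := by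
  have h2 : lampGens (2 ^ (k + 1)) r 2 = move _ := rfl
  rw [mk_moveWord, map_pow, FreeGroup.lift_apply_of, h2]
  ext1 ⟨f, p, c⟩
  rw [move_pow_apply, ZMod.natCast_self, add_zero, Equiv.Perm.one_apply]

theorem lift_lampGens_probeWord_ne_one (k : ℕ) :
    FreeGroup.lift (lampGens (2 ^ (k + 1)) (2 ^ k)) (FreeGroup.mk (probeWord k)) ≠ 1 := by
  intro h
  have h0 : lampGens (2 ^ (k + 1)) (2 ^ k) 0 = toggle _ := rfl
  have h1 : lampGens (2 ^ (k + 1)) (2 ^ k) 1 = readLamp _ _ := rfl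
  have h2 : lampGens (2 ^ (k + 1)) (2 ^ k) 2 = move _ := rfl
  have hz : (2 ^ k + 2 ^ k : ZMod (2 ^ (k + 1))) = 0 := by
    rw [← mul_two, ← pow_succ]
    exact_mod_cast ZMod.natCast_self (2 ^ (k + 1))
  rw [mk_probeWord] at h
  simp only [map_pow, map_mul, FreeGroup.lift_apply_of, h0, h1, h2] at h
  have := congrArg (fun g => (g (0, 0, 0)).2.2) h
  simp [pow_two, Equiv.Perm.mul_apply, readLamp_apply, toggle_apply, move_pow_apply, hz] at this

theorem not_dom_iff_exists_extPred (c : Nat.Partrec.Code) :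
    ¬ (c.eval 0).Dom ↔ ∃ n f, ExtPred lampMarking ⟨n, f⟩ ∧
      FreeGroup.lift f (FreeGroup.mk (moveWord (encode c + 1))) = 1 ∧
      FreeGroup.lift f (FreeGroup.mk (probeWord (encode c))) ≠ 1 := by
  have hc : Denumerable.ofNat Nat.Partrec.Code (encode c) = c := Denumerable.ofNat_encode c
  constructor
  · intro hdom
    have hr : IsGood (encode c + 1) (2 ^ encode c) :=
      isGood_two_pow fun m hm => hdom (hc ▸ hm.dom)
    have hlift : FreeGroup.lift (fun i => lampFinAction hr (lampMarking i)) =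
        (lampFinAction hr).comp (QuotientGroup.mk' lampRelators) :=
      FreeGroup.ext_hom _ _ fun i => by simp [lampMarking]
    refine ⟨_, fun i => lampFinAction hr (lampMarking i), ⟨lampFinAction hr, fun _ => rfl⟩, ?_, ?_⟩
    · rw [hlift]
      exact (lampFinAction_mk_eq_one_iff hr _).2 (lift_lampGens_moveWord _ _)
    · rw [hlift]
      exact fun h => lift_lampGens_probeWord_ne_one _ ((lampFinAction_mk_eq_one_iff hr _).1 h)
  · rintro ⟨n, f, hf, hu, hv⟩ hdom
    obtain ⟨m, hm⟩ := exists_haltsAt (k := encode c) (by rwa [hc])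
    exact hv (lift_probeWord_eq_one hf hm hu)

theorem not_computablePred_extPred_lampMarking : ¬ ComputablePred (ExtPred lampMarking) := by
  intro hE
  refine ComputablePred.halting_problem_not_re 0 ?_
  exact (re_exists_extPred closure_range_lampMarking primrecPred_wordProb_lampMarking hE
    (primrec_moveWord.comp (Primrec.succ.comp Primrec.encode))
    (primrec_probeWord.comp Primrec.encode)).of_eq fun c => (not_dom_iff_exists_extPred c).symm

end MarkedGroup

/-- There exists a finitely generated residually finite group with solvable word
problem whose finite quotients are not computable. -/
theorem statement_0 :
    ∃ (k : ℕ) (G : Type) (_ : Group G) (s : Fin k → G),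
      Subgroup.closure (Set.range s) = ⊤ ∧
      ResiduallyFinite G ∧
      ComputablePred (WordProb s) ∧
      ¬ ComputablePred (ExtPred s) := by
  exact ⟨3, LampGroup, inferInstance, lampMarking, closure_range_lampMarking,
    residuallyFinite_lampGroup, primrecPred_wordProb_lampMarking.computablePred,
    not_computablePred_extPred_lampMarking⟩

end CFQ
end

section
/- There exists a subset B ⊆ ℤ that is not recursively enumerable, but for which the function n ↦ (B mod n) is computable (i.e. B is determinable in the finite quotients of ℤ). -/
namespace CFQ

/-- A subset of `ℤ` is closed in the profinite topology on `ℤ` if every point of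
its complement is contained in an arithmetic progression avoiding the set. -/
def ProfiniteClosed (A : Set ℤ) : Prop :=
  ∀ x : ℤ, x ∉ A → ∃ b : ℤ, 1 ≤ b ∧ ∀ k : ℤ, x + b * k ∉ A

/-- The function `n ↦ (A mod n)` is computable. -/
def ModFunComputable (A : Set ℤ) : Prop :=
  ComputablePred fun p : ℕ × ℤ => 1 ≤ p.1 ∧ ∃ a ∈ A, a ≡ p.2 [ZMOD (p.1 : ℤ)]

theorem primrec_intNegSucc : Primrec Int.negSucc := by
  refine Primrec.encode_iff.1 ?_
  exact (Primrec.nat_double_succ).of_eq fun n => rfl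

/-- The nonnegative integers meet every residue class. -/
theorem exists_nonneg_modEq (n : ℕ) (hn : 1 ≤ n) (r : ℤ) :
    ∃ a : ℤ, 0 ≤ a ∧ a ≡ r [ZMOD (n : ℤ)] :=
  ⟨r % n, Int.emod_nonneg _ (by omega), Int.mod_modEq _ _⟩

theorem modFunComputable_of_nonneg_mem {A : Set ℤ} (hA : ∀ a : ℤ, 0 ≤ a → a ∈ A) :
    ModFunComputable A := by
  have h : PrimrecPred fun p : ℕ × ℤ => 1 ≤ p.1 :=
    Primrec.nat_le.comp (Primrec.const 1) Primrec.fst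
  refine h.computablePred.of_eq fun p => ⟨fun hp => ⟨hp, ?_⟩, And.left⟩
  obtain ⟨a, ha, hmod⟩ := exists_nonneg_modEq p.1 hp p.2
  exact ⟨a, hA a ha, hmod⟩

/-- There is a subset of `ℤ` which is not recursively enumerable but is determinable
in the finite quotients of `ℤ`. -/
theorem statement_4 :
    ∃ B : Set ℤ,
      ¬ RePred (fun x : ℤ => x ∈ B) ∧
      ModFunComputable B := by
  let B : Set ℤ := {x | ∀ c : Nat.Partrec.Code,
    x = Int.negSucc (Encodable.encode c) → ¬ (c.eval 0).Dom}
  refine ⟨B, ?_, modFunComputable_of_nonneg_mem ?_⟩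
  · rintro ⟨f, hf, hdom⟩
    refine ComputablePred.halting_problem_not_re 0 ?_
    have hg : Partrec fun c : Nat.Partrec.Code => f (Int.negSucc (Encodable.encode c)) :=
      hf.comp (primrec_intNegSucc.comp Primrec.encode).to_comp
    refine hg.dom_re.of_eq fun c => (hdom _).symm.trans ⟨fun h => h c rfl, ?_⟩
    intro h d hd
    rwa [← Encodable.encode_injective (Int.negSucc.inj hd)]
  · intro a ha c hc
    have := Int.negSucc_lt_zero (Encodable.encode c)
    omega

end CFQ
end

section
/- Let G be a group equipped with its profinite topology PT(G). For every subset B ⊆ G, the closure of B in PT(G) is exactly the set of x ∈ G such that for every n : ℕ and every group homomorphism φ : G →* Equiv.Perm (Fin n), φ x belongs to the image φ '' B. -/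
namespace CFQ

open Pointwise in
/-- The profinite topology on a group `G`, generated by cosets of finite index
normal subgroups. -/
def profiniteTopology (G : Type*) [Group G] : TopologicalSpace G :=
  TopologicalSpace.generateFrom
    {U : Set G | ∃ (g : G) (N : Subgroup G), N.Normal ∧ N.FiniteIndex ∧ U = g • (N : Set G)}

open Pointwise in
/-- The cosets of finite index normal subgroups form a neighbourhood basis of the
profinite topology. -/
theorem exists_normal_smul_subset_of_isOpen {G : Type*} [Group G] {U : Set G}
    (hU : @IsOpen G (profiniteTopology G) U) {x : G} (hx : x ∈ U) :
    ∃ N : Subgroup G, N.Normal ∧ N.FiniteIndex ∧ x • (N : Set G) ⊆ U := by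
  induction hU with
  | basic s hs =>
    obtain ⟨g, N, hN, hf, rfl⟩ := hs
    refine ⟨N, hN, hf, ?_⟩
    rintro _ ⟨y, hy, rfl⟩
    rw [Set.mem_smul_set_iff_inv_smul_mem] at hx ⊢
    simpa [mul_assoc] using N.mul_mem hx hy
  | univ => exact ⟨⊤, inferInstance, inferInstance, Set.subset_univ _⟩
  | inter s t _ _ ihs iht =>
    obtain ⟨N, hN, hNf, hNs⟩ := ihs hx.1
    obtain ⟨M, hM, hMf, hMt⟩ := iht hx.2
    exact ⟨N ⊓ M, inferInstance, inferInstance, Set.subset_inter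
      ((Set.smul_set_mono Set.inter_subset_left).trans hNs)
      ((Set.smul_set_mono Set.inter_subset_right).trans hMt)⟩
  | sUnion S _ ih =>
    obtain ⟨s, hs, hxs⟩ := hx
    obtain ⟨N, hN, hf, hNs⟩ := ih s hs hxs
    exact ⟨N, hN, hf, hNs.trans (Set.subset_sUnion_of_mem hs)⟩

/-- Every finite index normal subgroup is the kernel of a homomorphism to a finite
symmetric group. -/
theorem exists_perm_hom_ker_eq {G : Type*} [Group G] (N : Subgroup G) [N.Normal]
    [N.FiniteIndex] : ∃ (n : ℕ) (φ : G →* Equiv.Perm (Fin n)), φ.ker = N := by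
  let e := (Finite.equivFin (G ⧸ N)).permCongrHom
  refine ⟨Nat.card (G ⧸ N), (e : _ →* _).comp (MulAction.toPermHom G (G ⧸ N)), ?_⟩
  rw [MonoidHom.ker_mulEquiv_comp, ← Subgroup.normalCore_eq_ker, Subgroup.normalCore_eq_self]

/-- The closure of a subset `B` of a group in the profinite topology is the set of
elements that cannot be distinguished from `B` in any finite quotient. -/
theorem statement_5 {G : Type*} [Group G] (B : Set G) :
    @closure G (profiniteTopology G) B =
      {x : G | ∀ (n : ℕ) (φ : G →* Equiv.Perm (Fin n)), φ x ∈ φ '' B} := by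
  let := profiniteTopology G
  ext x
  rw [mem_closure_iff]
  constructor
  · intro hx n φ
    obtain ⟨_, ⟨y, hy, rfl⟩, hyB⟩ := hx _
      (TopologicalSpace.isOpen_generateFrom_of_mem ⟨x, φ.ker, inferInstance, inferInstance, rfl⟩)
      ⟨1, one_mem _, mul_one x⟩
    refine ⟨_, hyB, ?_⟩
    simpa using MonoidHom.mem_ker.mp hy
  · intro hx U hU hxU
    obtain ⟨N, hN, hf, hNU⟩ := exists_normal_smul_subset_of_isOpen hU hxU
    obtain ⟨n, φ, rfl⟩ := exists_perm_hom_ker_eq N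
    obtain ⟨b, hb, hbx⟩ := hx n φ
    refine ⟨b, hNU ⟨x⁻¹ * b, ?_, mul_inv_cancel_left x b⟩, hb⟩
    simp [MonoidHom.mem_ker, hbx]

end CFQ
end

section
/- Let (G, s : Fin k → G) be a marked group, let R be the finite residual of G (the intersection of all finite-index normal subgroups of G), and let π : G →* G ⧸ R be the quotient map, so that (G ⧸ R, π ∘ s) is a marking of the finitary image of G. Then the extension predicates coincide: for every pair (n, f), (n, f) ∈ E(G, s) if and only if (n, f) ∈ E(G ⧸ R, π ∘ s). In particular, G has CFQ (respectively ReFQ, co-ReFQ) if and only if its finitary image G ⧸ R has CFQ (respectively ReFQ, co-ReFQ). -/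
namespace CFQ

/-- The finite residual of a group: the intersection of all its finite-index
normal subgroups. -/
def finiteResidual (G : Type*) [Group G] : Subgroup G :=
  ⨅ (N : Subgroup G) (_ : N.Normal) (_ : N.FiniteIndex), N

instance finiteResidual_normal (G : Type*) [Group G] : (finiteResidual G).Normal := by
  constructor
  intro x hx g
  simp only [finiteResidual, Subgroup.mem_iInf] at hx ⊢
  intro N hN hFI
  exact hN.conj_mem x (hx N hN hFI) g

theorem finiteResidual_le_ker {G H : Type*} [Group G] [Group H] [Finite H] (φ : G →* H) :
    finiteResidual G ≤ φ.ker :=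
  iInf_le_of_le φ.ker <| iInf_le_of_le inferInstance <| iInf_le_of_le inferInstance le_rfl

theorem extPred_finiteResidual_iff {k : ℕ} {G : Type*} [Group G] (s : Fin k → G)
    (p : Σ n : ℕ, Fin k → Equiv.Perm (Fin n)) :
    ExtPred s p ↔ ExtPred (QuotientGroup.mk' (finiteResidual G) ∘ s) p := by
  constructor
  · rintro ⟨φ, hφ⟩
    exact ⟨QuotientGroup.lift (finiteResidual G) φ (finiteResidual_le_ker φ), hφ⟩
  · rintro ⟨φ, hφ⟩
    exact ⟨φ.comp (QuotientGroup.mk' (finiteResidual G)), hφ⟩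

/-- A group and its finitary image have the same extension predicate; in particular
one has CFQ (resp. ReFQ, co-ReFQ) iff the other does. -/
theorem statement_10 {k : ℕ} {G : Type*} [Group G] (s : Fin k → G)
    (hgen : Subgroup.closure (Set.range s) = ⊤) :
    (∀ p : Σ n : ℕ, Fin k → Equiv.Perm (Fin n),
      ExtPred s p ↔ ExtPred (QuotientGroup.mk' (finiteResidual G) ∘ s) p) ∧
    (ComputablePred (ExtPred s) ↔
      ComputablePred (ExtPred (QuotientGroup.mk' (finiteResidual G) ∘ s))) ∧
    (RePred (ExtPred s) ↔
      RePred (ExtPred (QuotientGroup.mk' (finiteResidual G) ∘ s))) ∧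
    (RePred (fun p => ¬ ExtPred s p) ↔
      RePred (fun p => ¬ ExtPred (QuotientGroup.mk' (finiteResidual G) ∘ s) p)) := by
  have h : ExtPred s = ExtPred (QuotientGroup.mk' (finiteResidual G) ∘ s) :=
    funext fun p => propext (extPred_finiteResidual_iff s p)
  rw [← h]
  exact ⟨fun _ => Iff.rfl, Iff.rfl, Iff.rfl, Iff.rfl⟩

end CFQ
end

section
/- Let G be a residually finite group and H a subgroup of G. The double of G over H — the amalgamated free product G ∗_H G of two copies of G over H, i.e. the pushout of the two copies of the inclusion homomorphism H → G — is residually finite if and only if H is separable in G, meaning that for every g ∈ G with g ∉ H there exist n : ℕ and a group homomorphism φ : G →* Equiv.Perm (Fin n) such that φ g ∉ φ '' H. -/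
namespace CFQ

theorem exists_perm_fin_embedding (K : Type*) [Group K] [Finite K] :
    ∃ (n : ℕ) (ψ : K →* Equiv.Perm (Fin n)), Function.Injective ψ :=
  ⟨Nat.card K, (Finite.equivFin K).permCongrHom.toMonoidHom.comp (MulAction.toPermHom K K),
    (Finite.equivFin K).permCongrHom.injective.comp MulAction.toPerm_injective⟩

/-- A subgroup that is separable from each single element by homomorphisms to finite groups
is separable from finitely many elements at once. -/
theorem exists_finite_hom_forall_notMem {G : Type*} [Group G] {H : Subgroup G}
    (hH : ∀ g : G, g ∉ H →
      ∃ (n : ℕ) (φ : G →* Equiv.Perm (Fin n)), φ g ∉ φ '' (H : Set G))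
    (l : List G) (hl : ∀ g ∈ l, g ∉ H) :
    ∃ (Q : Type) (_ : Group Q) (_ : Finite Q) (f : G →* Q), ∀ g ∈ l, f g ∉ H.map f := by
  induction l with
  | nil => exact ⟨Unit, inferInstance, inferInstance, 1, by simp⟩
  | cons a l ih =>
    obtain ⟨Q, _, _, f, hf⟩ := ih fun g hg => hl g (List.mem_cons_of_mem _ hg)
    obtain ⟨n, φ, hφ⟩ := hH a (hl a List.mem_cons_self)
    refine ⟨Equiv.Perm (Fin n) × Q, inferInstance, inferInstance, φ.prod f, ?_⟩
    rintro g hg ⟨h, hh, hhg⟩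
    obtain ⟨h₁, h₂⟩ := Prod.ext_iff.1 hhg
    rcases List.mem_cons.1 hg with rfl | hg
    · exact hφ ⟨h, hh, h₁⟩
    · exact hf g hg ⟨h, hh, h₂⟩

section LevelSwap

variable {Q : Type*} [Group Q] (P : Subgroup Q) (s : ℕ → Q) (n : ℕ)

open Classical in
/-- The map on `n + 1` copies of `Q` exchanging, for each `k < n`, the element `p * s k` of the
`k`-th copy with the element `p` of the next copy, for all `p ∈ P`. -/
noncomputable def levelSwap (x : Q × Fin (n + 1)) : Q × Fin (n + 1) :=
  if h : x.2.1 < n ∧ x.1 * (s x.2)⁻¹ ∈ P then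
    (x.1 * (s x.2)⁻¹, ⟨x.2 + 1, Nat.succ_lt_succ h.1⟩)
  else if 0 < x.2.1 ∧ x.1 ∈ P then
    (x.1 * s (x.2 - 1), ⟨x.2 - 1, (Nat.sub_le _ _).trans_lt x.2.2⟩)
  else x

variable {s n}

theorem levelSwap_up {k : ℕ} (hk : k < n) {p : Q} (hp : p ∈ P) :
    levelSwap P s n (p * s k, ⟨k, hk.trans n.lt_succ_self⟩) =
      (p, ⟨k + 1, Nat.succ_lt_succ hk⟩) := by
  simp [levelSwap, hk, hp]

theorem levelSwap_mul_left {p : Q} (hp : p ∈ P) (x : Q × Fin (n + 1)) :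
    levelSwap P s n (p * x.1, x.2) =
      (p * (levelSwap P s n x).1, (levelSwap P s n x).2) := by
  have h₁ : p * x.1 * (s x.2)⁻¹ ∈ P ↔ x.1 * (s x.2)⁻¹ ∈ P := by
    rw [mul_assoc, P.mul_mem_cancel_left hp]
  have h₂ : p * x.1 ∈ P ↔ x.1 ∈ P := P.mul_mem_cancel_left hp
  simp only [levelSwap]
  split_ifs <;> first | (exfalso; tauto) | simp [mul_assoc]

variable {P}

theorem levelSwap_down (hs : ∀ k < n, s k ∉ P) {k : ℕ} (hk : k < n) {p : Q} (hp : p ∈ P) :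
    levelSwap P s n (p, ⟨k + 1, Nat.succ_lt_succ hk⟩) =
      (p * s k, ⟨k, hk.trans n.lt_succ_self⟩) := by
  have : ¬ (k + 1 < n ∧ p * (s (k + 1))⁻¹ ∈ P) := fun h =>
    hs _ h.1 (by simpa [P.mul_mem_cancel_left hp] using h.2)
  simp [levelSwap, this, hp]

theorem levelSwap_one_zero (hs : ∀ k < n, s k ∉ P) : levelSwap P s n (1, 0) = (1, 0) := by
  have : ¬ (0 < n ∧ s 0 ∈ P) := fun h => hs 0 h.1 h.2
  simp [levelSwap, this]

theorem levelSwap_involutive (hs : ∀ k < n, s k ∉ P) :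
    Function.Involutive (levelSwap P s n) := by
  rintro ⟨q, k, hk⟩
  by_cases h₁ : k < n ∧ q * (s k)⁻¹ ∈ P
  · obtain ⟨hkn, hq⟩ := h₁
    have := levelSwap_up P (s := s) hkn hq
    rw [inv_mul_cancel_right] at this
    rw [this, levelSwap_down hs hkn hq, inv_mul_cancel_right]
  · by_cases h₂ : 0 < k ∧ q ∈ P
    · obtain ⟨k, rfl⟩ := Nat.exists_eq_succ_of_ne_zero h₂.1.ne'
      have hkn : k < n := Nat.lt_of_succ_lt_succ hk
      exact (congrArg _ (levelSwap_down hs hkn h₂.2)).trans (levelSwap_up P hkn h₂.2)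
    · have : levelSwap P s n (q, ⟨k, hk⟩) = (q, ⟨k, hk⟩) := by
        simp only [levelSwap]
        rw [dif_neg h₁, if_neg h₂]
      rw [this, this]

end LevelSwap

/-- The action of a group on several copies of itself by left multiplication. -/
def leftMulPerm (Q A : Type*) [Group Q] : Q →* Equiv.Perm (Q × A) where
  toFun q := (Equiv.mulLeft q).prodCongr (Equiv.refl A)
  map_one' := by ext <;> simp
  map_mul' a b := by ext <;> simp [mul_assoc]

/-- For an involution `σ`, the identity or `σ` according to a boolean. -/
def involutionPow {X : Type*} (σ : Equiv.Perm X) (i : Bool) : Equiv.Perm X :=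
  if i then σ else 1

theorem involutionPow_mul_self {X : Type*} {σ : Equiv.Perm X} (hσ : σ * σ = 1) (i : Bool) :
    involutionPow σ i * involutionPow σ i = 1 := by
  cases i <;> simp [involutionPow, hσ]

theorem involutionPow_mul_of_ne {X : Type*} (σ : Equiv.Perm X) {i j : Bool} (hij : i ≠ j) :
    involutionPow σ i * involutionPow σ j = σ := by
  cases i <;> cases j <;> simp_all [involutionPow]

/-- The homomorphism out of a double given by an action of `G` on the first factor, and its
conjugate by an involution `σ` centralizing the action of `H` on the second. -/
def doubleLift {G X : Type*} [Group G] {H : Subgroup G} (f : G →* Equiv.Perm X)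
    (σ : Equiv.Perm X) (hc : ∀ h ∈ H, Commute σ (f h)) :
    Monoid.PushoutI (fun _ : Bool => H.subtype) →* Equiv.Perm X :=
  Monoid.PushoutI.lift
    (fun i => (MulAut.conj (involutionPow σ i)).toMonoidHom.comp f) (f.comp H.subtype) (by
      intro i
      ext1 h
      cases i
      · simp [involutionPow]
      · simp [involutionPow, (hc h h.2).eq])

theorem doubleLift_of {G X : Type*} [Group G] {H : Subgroup G} (f : G →* Equiv.Perm X)
    {σ : Equiv.Perm X} (hσ : σ * σ = 1) (hc : ∀ h ∈ H, Commute σ (f h)) (i : Bool) (g : G) :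
    doubleLift f σ hc (Monoid.PushoutI.of i g) =
      involutionPow σ i * f g * involutionPow σ i := by
  rw [doubleLift, Monoid.PushoutI.lift_of]
  simp [inv_eq_of_mul_eq_one_left (involutionPow_mul_self hσ i)]

/-- A nonempty alternating word whose letters stay outside the amalgamated subgroup after mapping
to a finite group `Q` acts nontrivially on some finite set. In the action on copies of `Q`
twisted by `levelSwap`, each letter moves the base point up by one level. -/
theorem exists_finite_hom_ne_one_of_word {G : Type*} {Q : Type} [Group G] [Group Q] [Finite Q]
    {H : Subgroup G} (f : G →* Q) (w : Monoid.CoprodI.Word (fun _ : Bool => G))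
    (hw : w.toList ≠ []) (hf : ∀ x ∈ w.toList, f x.2 ∉ H.map f) (h : H) :
    ∃ (X : Type) (_ : Finite X)
      (ψ : Monoid.PushoutI (fun _ : Bool => H.subtype) →* Equiv.Perm X),
      ψ (Monoid.PushoutI.base _ h * Monoid.PushoutI.ofCoprodI w.prod) ≠ 1 := by
  obtain ⟨L, hL, hchain⟩ := w
  dsimp only at hw hf
  set s : ℕ → Q := fun k => ((L.reverse.map fun x => f x.2)[k]?).getD 1 with hs_def
  have hs : ∀ k < L.length, s k ∉ H.map f := by
    intro k hk
    have hk' : k < L.reverse.length := by simpa using hk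
    simp only [hs_def, List.getElem?_map, List.getElem?_eq_getElem hk', Option.map_some,
      Option.getD_some]
    exact hf _ (List.mem_reverse.1 (List.getElem_mem hk'))
  let σ : Equiv.Perm (Q × Fin (L.length + 1)) := (levelSwap_involutive hs).toPerm
  have hσ : σ * σ = 1 := by
    ext1 x
    exact levelSwap_involutive hs x
  let F := (leftMulPerm Q (Fin (L.length + 1))).comp f
  have hc : ∀ h ∈ H, Commute σ (F h) := fun h hh => by
    ext1 x
    exact levelSwap_mul_left _ (Subgroup.mem_map_of_mem f hh) x
  let ψ := doubleLift F σ hc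
  refine ⟨Q × Fin (L.length + 1), inferInstance, ψ, ?_⟩
  have hfix : ∀ i, involutionPow σ i (1, 0) = (1, 0) := fun i => by
    cases i
    · rfl
    · exact levelSwap_one_zero hs
  have key : ∀ l : List (Σ _ : Bool, G), ∀ hl : l <:+ L, ∀ i, (∀ x ∈ l.head?, i ≠ x.1) →
      involutionPow σ i ((l.map fun x => ψ (Monoid.PushoutI.of x.1 x.2)).prod (1, 0)) =
        (1, ⟨l.length, Nat.lt_succ_of_le hl.length_le⟩) := by
    intro l
    induction l with
    | nil => exact fun _ i _ => hfix i
    | cons x l ih =>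
      intro hl i hi
      have hxl := hchain.suffix hl
      have hl' : l <:+ L := (List.suffix_cons x l).trans hl
      have hlen : l.length < L.length := hl.length_le
      have hsx : s l.length = f x.2 := by
        obtain ⟨t, rfl⟩ := hl
        simp [hs_def]
      have hstep := ih hl' x.1 fun y hy => by
        rcases l with _ | ⟨z, l⟩
        · simp at hy
        · obtain rfl : z = y := by simpa using hy
          exact (List.isChain_cons_cons.1 hxl).1
      have hix : i ≠ x.1 := hi x (by simp)
      rw [List.map_cons, List.prod_cons, doubleLift_of F hσ hc, Equiv.Perm.mul_apply,
        Equiv.Perm.mul_apply, Equiv.Perm.mul_apply, hstep, ← Equiv.Perm.mul_apply, involutionPow_mul_of_ne σ hix]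
      have := levelSwap_up (H.map f) (s := s) hlen (one_mem _)
      rw [one_mul, hsx] at this
      simpa [F, leftMulPerm, σ] using this
  intro hone
  obtain ⟨i, hi⟩ : ∃ i : Bool, ∀ x ∈ L.head?, i ≠ x.1 := by
    rcases L with _ | ⟨x, L⟩
    · exact absurd rfl hw
    · exact ⟨!x.1, by simp⟩
  have hend := key L List.suffix_rfl i hi
  have hprod : ψ (Monoid.PushoutI.ofCoprodI
      (Monoid.CoprodI.Word.prod ⟨L, hL, hchain⟩)) =
      (L.map fun x => ψ (Monoid.PushoutI.of x.1 x.2)).prod := by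
    simp [Monoid.CoprodI.Word.prod, map_list_prod, Function.comp_def]
  have hbase : ψ (Monoid.PushoutI.base _ h) = F h :=
    Monoid.PushoutI.lift_base _ _ _ _
  have hcomm : Commute (involutionPow σ i) (F h) := by
    cases i
    · exact Commute.one_left _
    · exact hc h h.2
  rw [map_mul, hprod, hbase] at hone
  have hpt := congrArg (involutionPow σ i) (congrArg (· (1, 0)) hone)
  simp only [Equiv.Perm.one_apply, hfix] at hpt
  rw [← Equiv.Perm.mul_apply, ← mul_assoc, hcomm.eq, mul_assoc, Equiv.Perm.mul_apply,
    Equiv.Perm.mul_apply, hend] at hpt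
  have hlevel : L.length = 0 := congrArg (fun x => (x.2 : ℕ)) hpt
  exact hw (List.length_eq_zero_iff.1 hlevel)

/-- Every element of a double is the product of an element of the amalgamated subgroup and an
alternating word whose letters lie outside that subgroup. -/
theorem exists_eq_base_mul_word {G : Type*} [Group G] {H : Subgroup G}
    (x : Monoid.PushoutI (fun _ : Bool => H.subtype)) :
    ∃ (h : H) (w : Monoid.CoprodI.Word (fun _ : Bool => G)),
      (∀ y ∈ w.toList, y.2 ∉ H) ∧
        x = Monoid.PushoutI.base _ h * Monoid.PushoutI.ofCoprodI w.prod := by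
  classical
  obtain ⟨d⟩ := Monoid.PushoutI.NormalWord.transversal_nonempty
    (fun _ : Bool => H.subtype) (fun _ => H.subtype_injective)
  obtain ⟨w, rfl⟩ := (Monoid.PushoutI.NormalWord.equiv (d := d)).symm.surjective x
  refine ⟨w.head, w.toWord, ?_, rfl⟩
  rintro ⟨i, g⟩ hg hgH
  refine w.ne_one _ hg ?_
  have := (d.compl i).1 (a₁ := (⟨g, ⟨⟨g, hgH⟩, rfl⟩⟩, ⟨1, d.one_mem i⟩))
    (a₂ := (1, ⟨g, w.normalized i g hg⟩)) (by simp)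
  simpa using congrArg (fun y => (y.1 : G)) this

theorem separable_of_residuallyFinite_double {G : Type*} [Group G] {H : Subgroup G}
    (hD : ResiduallyFinite (Monoid.PushoutI (fun _ : Bool => H.subtype))) (g : G) (hg : g ∉ H) :
    ∃ (n : ℕ) (φ : G →* Equiv.Perm (Fin n)), φ g ∉ φ '' (H : Set G) := by
  let ι (i : Bool) : G →* Monoid.PushoutI (fun _ : Bool => H.subtype) :=
    Monoid.PushoutI.of (G := fun _ : Bool => G) i
  have hinj : ∀ _ : Bool, Function.Injective H.subtype := fun _ => H.subtype_injective
  have hne : ι true g * (ι false g)⁻¹ ≠ 1 := by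
    intro h
    have hmem : ι true g ∈ (Monoid.PushoutI.base (fun _ : Bool => H.subtype)).range := by
      rw [← Monoid.PushoutI.inf_of_range_eq_base_range hinj (Bool.true_eq_false_eq_False)]
      exact ⟨⟨g, rfl⟩, ⟨g, (mul_inv_eq_one.1 h).symm⟩⟩
    obtain ⟨h, hh⟩ := hmem
    rw [← Monoid.PushoutI.of_apply_eq_base _ true] at hh
    exact hg (Monoid.PushoutI.of_injective hinj true hh ▸ h.2)
  obtain ⟨n, φ, hφ⟩ := hD _ hne
  obtain ⟨m, ψ, hψ⟩ := exists_perm_fin_embedding (Equiv.Perm (Fin n) × Equiv.Perm (Fin n))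
  refine ⟨m, ψ.comp ((φ.comp (ι true)).prod (φ.comp (ι false))), ?_⟩
  rintro ⟨h, hh, heq⟩
  obtain ⟨h₁, h₂⟩ := Prod.ext_iff.1 (hψ heq)
  have hdiag : ι true h = ι false h :=
    (Monoid.PushoutI.of_apply_eq_base (fun _ : Bool => H.subtype) true ⟨h, hh⟩).trans
      (Monoid.PushoutI.of_apply_eq_base (fun _ : Bool => H.subtype) false ⟨h, hh⟩).symm
  apply hφ
  rw [map_mul, map_inv, mul_inv_eq_one]
  exact h₁.symm.trans ((congrArg φ hdiag).trans h₂)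

theorem residuallyFinite_double_of_separable {G : Type*} [Group G] (hG : ResiduallyFinite G)
    {H : Subgroup G}
    (hH : ∀ g : G, g ∉ H →
      ∃ (n : ℕ) (φ : G →* Equiv.Perm (Fin n)), φ g ∉ φ '' (H : Set G)) :
    ResiduallyFinite (Monoid.PushoutI (fun _ : Bool => H.subtype)) := by
  intro x hx
  obtain ⟨h, w, hw, rfl⟩ := exists_eq_base_mul_word x
  by_cases hnil : w.toList = []
  · obtain rfl : w = .empty := Monoid.CoprodI.Word.ext hnil
    simp only [Monoid.CoprodI.Word.prod_empty, map_one, mul_one] at hx ⊢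
    have hh : (h : G) ≠ 1 := by
      rintro hh
      obtain rfl : h = 1 := Subtype.ext hh
      exact hx (map_one _)
    obtain ⟨n, φ, hφ⟩ := hG h hh
    refine ⟨n, φ.comp
      (Monoid.PushoutI.lift (fun _ => MonoidHom.id G) H.subtype fun _ => rfl), ?_⟩
    simpa using hφ
  · obtain ⟨Q, _, _, f, hf⟩ := exists_finite_hom_forall_notMem hH (w.toList.map Sigma.snd)
      (List.forall_mem_map.2 hw)
    obtain ⟨X, _, ψ, hψ⟩ := exists_finite_hom_ne_one_of_word f w hnil
      (fun y hy => hf _ (List.mem_map_of_mem hy)) h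
    obtain ⟨n, θ, hθ⟩ := exists_perm_fin_embedding (Equiv.Perm X)
    exact ⟨n, θ.comp ψ, fun h1 => hψ (hθ (h1.trans (map_one θ).symm))⟩

/-- The double of a residually finite group `G` over a subgroup `H` (the pushout of
the two copies of the inclusion `H → G`) is residually finite iff `H` is separable
in `G`. -/
theorem statement_19 {G : Type*} [Group G] (hG : ResiduallyFinite G) (H : Subgroup G) :
    ResiduallyFinite (Monoid.PushoutI (fun _ : Bool => H.subtype)) ↔
      ∀ g : G, g ∉ H →
        ∃ (n : ℕ) (φ : G →* Equiv.Perm (Fin n)), φ g ∉ φ '' (H : Set G) := by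
  exact ⟨separable_of_residuallyFinite_double, residuallyFinite_double_of_separable hG⟩

end CFQ
end
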